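/- Assume f satisfies (f1), (f2) with B > 0, and (f3). Then for every a with 0 < a < ∞, the exterior problem (R) with b = ∞ has at most one positive solution; that is, any two positive solutions of the exterior problem coincide on [a,∞). -/

import Mathlib

open Set Filter MeasureTheory

/-- `F(s) = ∫₀ˢ f(t) dt`. -/
noncomputable def Fint (f : ℝ → ℝ) (s : ℝ) : ℝ := ∫ t in (0:ℝ)..s, f t

/-- Condition (f1): `f` is continuous on `[0,∞)`, continuously differentiable on `(0,∞)`,
and `f' ∈ L¹(0,1)`. -/
def CondF1 (f : ℝ → ℝ) : Prop :=
  ContinuousOn f (Ici 0) ∧ (∀ s ∈ Ioi (0:ℝ), DifferentiableAt ℝ f s) ∧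
  ContinuousOn (deriv f) (Ioi 0) ∧ IntervalIntegrable (deriv f) volume 0 1

/-- Condition (f2) in the case `β > B > 0`. -/
def CondF2B (f : ℝ → ℝ) (β B : ℝ) : Prop :=
  f 0 = 0 ∧ 0 < B ∧ B < β ∧ (∀ s, B < s → 0 < f s) ∧
  (∀ s ∈ Icc (0:ℝ) B, f s ≤ 0) ∧ (∃ ε > (0:ℝ), ∀ s ∈ Ioo (0:ℝ) ε, f s < 0) ∧
  Fint f β = 0

/-- Condition (f2): either `β = B = 0` and `f > 0` on `(0,∞)`, or `β > B > 0` with the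
sign conditions and `F(β) = 0`. -/
def CondF2 (f : ℝ → ℝ) (β B : ℝ) : Prop :=
  (β = 0 ∧ B = 0 ∧ f 0 = 0 ∧ ∀ s, 0 < s → 0 < f s) ∨ CondF2B f β B

/-- Condition (f3): the derivative of `s ↦ F(s)/f(s)` is `≥ (n-2)/(2n)` for every `s > β`. -/
def CondF3 (n : ℕ) (f : ℝ → ℝ) (β : ℝ) : Prop :=
  ∀ s, β < s → ∃ d, ((n : ℝ) - 2) / (2 * (n : ℝ)) ≤ d ∧
    HasDerivAt (fun t => Fint f t / f t) d s

/-- Condition (f4): superlinearity `f(s) ≤ f'(s)(s - B)` for `s > B`, with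
`f(s) ≢ f'(s)(s - B)` on `[B, β]`. -/
def CondF4 (f : ℝ → ℝ) (β B : ℝ) : Prop :=
  (∀ s, B < s → f s ≤ deriv f s * (s - B)) ∧
  ¬ (∀ s ∈ Icc B β, f s = deriv f s * (s - B))

/-- A positive solution of problem (R) on the annulus `a < |x| < b`:
`u` is continuous on `[a,b]`, differentiable up to the boundary with derivative `u'`
(one-sided at the endpoints), `u'` is continuous on `[a,b]`, `u` is twice continuously
differentiable on `(a,b)` where it satisfies `u'' + ((n-1)/r) u' + f(u) = 0`,
`u(a) = u(b) = 0` and `u > 0` on `(a,b)`. -/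
def IsPosSolAnn (n : ℕ) (a b : ℝ) (f u u' : ℝ → ℝ) : Prop :=
  ContinuousOn u (Icc a b) ∧
  (∀ r ∈ Icc a b, HasDerivWithinAt u (u' r) (Icc a b) r) ∧
  ContinuousOn u' (Icc a b) ∧
  (∀ r ∈ Ioo a b, HasDerivAt u (u' r) r) ∧
  (∀ r ∈ Ioo a b, HasDerivAt u' (-(((n : ℝ) - 1) / r * u' r + f (u r))) r) ∧
  u a = 0 ∧ u b = 0 ∧ (∀ r ∈ Ioo a b, 0 < u r)

/-- A positive solution of the exterior problem (R) with `b = ∞`: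
`u` is continuous on `[a,∞)`, differentiable on `[a,∞)` with derivative `u'`
(one-sided at `a`), twice continuously differentiable on `(a,∞)` where it satisfies
`u'' + ((n-1)/r) u' + f(u) = 0`, `u(a) = 0`, `u > 0` on `(a,∞)` and `u(r) → 0` as `r → ∞`. -/
def IsPosSolExt (n : ℕ) (a : ℝ) (f u u' : ℝ → ℝ) : Prop :=
  ContinuousOn u (Ici a) ∧
  (∀ r ∈ Ici a, HasDerivWithinAt u (u' r) (Ici a) r) ∧
  (∀ r ∈ Ioi a, HasDerivAt u (u' r) r) ∧
  (∀ r ∈ Ioi a, HasDerivAt u' (-(((n : ℝ) - 1) / r * u' r + f (u r))) r) ∧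
  u a = 0 ∧ (∀ r ∈ Ioi a, 0 < u r) ∧
  Tendsto u atTop (nhds 0)

/-- The Erbe–Tang functional
`P(s) = -2n (F(s)/f(s)) ρ(s)^{n-1} u'(ρ(s)) - ρ(s)^n (u'(ρ(s)))² - 2 ρ(s)^n F(s)`,
where `ρ` is an inverse branch of the solution `u` with derivative `u'`. -/
noncomputable def Pfun (n : ℕ) (f : ℝ → ℝ) (ρ u' : ℝ → ℝ) (s : ℝ) : ℝ :=
  -2 * (n : ℝ) * (Fint f s / f s) * (ρ s) ^ (n - 1) * u' (ρ s)
    - (ρ s) ^ n * (u' (ρ s)) ^ 2 - 2 * (ρ s) ^ n * Fint f s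

section PartF

lemma F_hasDerivAt {f : ℝ → ℝ} (hf : ContinuousOn f (Ici 0)) {s : ℝ} (hs : 0 < s) :
    HasDerivAt (Fint f) (f s) s := by
  unfold Fint
  apply intervalIntegral.integral_hasDerivAt_right
  · apply ContinuousOn.intervalIntegrable
    rw [uIcc_of_le hs.le]
    exact hf.mono (fun x hx => hx.1)
  · exact (hf.mono (fun x (hx : x ∈ Ioi (0:ℝ)) => mem_Ici.mpr (le_of_lt hx))).stronglyMeasurableAtFilter isOpen_Ioi s hs
  · exact hf.continuousAt (Ici_mem_nhds hs)

lemma F_cont {f : ℝ → ℝ} (hf : ContinuousOn f (Ici 0)) : ContinuousOn (Fint f) (Ici 0) := by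
  intro x hx
  have hx0 : (0:ℝ) ≤ x := hx
  have h : ContinuousOn (Fint f) (Icc 0 (x+1)) := by
    unfold Fint
    have := intervalIntegral.continuousOn_primitive_interval' (μ := volume) (f := f) (a := 0) (b₁ := 0) (b₂ := x+1)
      (by
        apply ContinuousOn.intervalIntegrable
        rw [uIcc_of_le (by linarith)]
        exact hf.mono (fun x hx => hx.1)) (by simp)
    rwa [uIcc_of_le (by linarith)] at this
  have := h x ⟨hx0, by linarith⟩
  refine this.mono_of_mem_nhdsWithin ?_
  rw [mem_nhdsWithin]
  exact ⟨Iio (x+1), isOpen_Iio, by simp, fun y hy => ⟨hy.2, le_of_lt hy.1⟩⟩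

lemma F_zero (f : ℝ → ℝ) : Fint f 0 = 0 := by simp [Fint]

/-- mean value monotonicity with pointwise derivatives -/
lemma anti_of_hd {g g' : ℝ → ℝ} {l u : ℝ} (hlu : l ≤ u) (hc : ContinuousOn g (Icc l u))
    (hd : ∀ x ∈ Ioo l u, HasDerivAt g (g' x) x) (hg : ∀ x ∈ Ioo l u, g' x ≤ 0) : g u ≤ g l := by
  have : AntitoneOn g (Icc l u) := by
    apply antitoneOn_of_deriv_nonpos (convex_Icc l u) hc
    · rw [interior_Icc]; exact fun x hx => (hd x hx).differentiableAt.differentiableWithinAt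
    · rw [interior_Icc]; intro x hx; rw [(hd x hx).deriv]; exact hg x hx
  exact this ⟨le_rfl, hlu⟩ ⟨hlu, le_rfl⟩ hlu

lemma mono_of_hd {g g' : ℝ → ℝ} {l u : ℝ} (hlu : l ≤ u) (hc : ContinuousOn g (Icc l u))
    (hd : ∀ x ∈ Ioo l u, HasDerivAt g (g' x) x) (hg : ∀ x ∈ Ioo l u, 0 ≤ g' x) : g l ≤ g u := by
  have := anti_of_hd (g := fun x => - g x) (g' := fun x => - g' x) hlu hc.neg
    (fun x hx => (hd x hx).neg) (fun x hx => by simpa using hg x hx)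
  simpa using this

lemma F_nonpos {f : ℝ → ℝ} {β B : ℝ} (hf : ContinuousOn f (Ici 0)) (h2 : CondF2B f β B)
    {s : ℝ} (hs : s ∈ Icc 0 β) : Fint f s ≤ 0 := by
  obtain ⟨h0, hB, hBβ, hpos, hneg, -, hFβ⟩ := h2
  rcases le_total s B with h | h
  · have := anti_of_hd (g := Fint f) (g' := f) hs.1 ((F_cont hf).mono (fun x hx => hx.1))
      (fun x hx => F_hasDerivAt hf hx.1) (fun x hx => hneg x ⟨hx.1.le, hx.2.le.trans h⟩)
    rwa [F_zero] at this
  · have := mono_of_hd (g := Fint f) (g' := f) hs.2 ((F_cont hf).mono (fun x hx => hs.1.trans hx.1))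
      (fun x hx => F_hasDerivAt hf (hs.1.trans_lt hx.1)) (fun x hx => (hpos x (h.trans_lt hx.1)).le)
    rwa [hFβ] at this

lemma F_pos {f : ℝ → ℝ} {β B : ℝ} (hf : ContinuousOn f (Ici 0)) (h2 : CondF2B f β B)
    {s : ℝ} (hs : β < s) : 0 < Fint f s := by
  obtain ⟨h0, hB, hBβ, hpos, hneg, -, hFβ⟩ := h2
  have hmono : StrictMonoOn (Fint f) (Icc β s) := by
    apply strictMonoOn_of_deriv_pos (convex_Icc _ _)
    · exact (F_cont hf).mono (fun x hx => (hB.trans hBβ).le.trans hx.1)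
    · rw [interior_Icc]; intro x hx
      rw [(F_hasDerivAt hf (by linarith [hx.1])).deriv]
      exact hpos x (by linarith [hx.1])
  have := hmono ⟨le_rfl, hs.le⟩ ⟨hs.le, le_rfl⟩ hs
  rwa [hFβ] at this

/-- continuous induction upwards -/
lemma boot_up {z : ℝ → ℝ} {l u : ℝ} (hz : ContinuousOn z (Icc l u))
    (h : ∀ t ∈ Icc l u, (∀ s ∈ Ico l t, z s < 0) → z t < 0) : ∀ t ∈ Icc l u, z t < 0 := by
  by_contra hcon
  push Not at hcon
  obtain ⟨t, ht, hzt⟩ := hcon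
  have hcl : IsCompact (Icc l u ∩ z ⁻¹' (Ici 0)) :=
    isCompact_Icc.of_isClosed_subset (hz.preimage_isClosed_of_isClosed isClosed_Icc isClosed_Ici)
      inter_subset_left
  obtain ⟨m, hm, hmin⟩ := hcl.exists_isLeast ⟨t, ht, hzt⟩
  have := h m hm.1 (fun s hs => by
    by_contra hh
    push Not at hh
    have := hmin ⟨⟨hs.1, hs.2.le.trans hm.1.2⟩, hh⟩
    linarith [hs.2])
  exact absurd hm.2 (not_le.mpr this)

/-- continuous induction downwards -/
lemma boot_down {z : ℝ → ℝ} {l u : ℝ} (hz : ContinuousOn z (Icc l u))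
    (h : ∀ t ∈ Icc l u, (∀ s ∈ Ioc t u, z s < 0) → z t < 0) : ∀ t ∈ Icc l u, z t < 0 := by
  by_contra hcon
  push Not at hcon
  obtain ⟨t, ht, hzt⟩ := hcon
  have hcl : IsCompact (Icc l u ∩ z ⁻¹' (Ici 0)) :=
    isCompact_Icc.of_isClosed_subset (hz.preimage_isClosed_of_isClosed isClosed_Icc isClosed_Ici)
      inter_subset_left
  obtain ⟨m, hm, hmax⟩ := hcl.exists_isGreatest ⟨t, ht, hzt⟩
  have := h m hm.1 (fun s hs => by
    by_contra hh
    push Not at hh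
    have := hmax ⟨⟨hm.1.1.trans hs.1.le, hs.2⟩, hh⟩
    linarith [hs.1])
  exact absurd hm.2 (not_le.mpr this)

/-- last nonnegative point -/
lemma last_nonneg {z : ℝ → ℝ} {l u : ℝ} (hz : ContinuousOn z (Icc l u)) {t : ℝ} (ht : t ∈ Icc l u)
    (hzt : 0 ≤ z t) (hu : z u < 0) :
    ∃ m ∈ Ico l u, z m = 0 ∧ t ≤ m ∧ ∀ s ∈ Ioc m u, z s < 0 := by
  have hcl : IsCompact (Icc l u ∩ z ⁻¹' (Ici 0)) :=
    isCompact_Icc.of_isClosed_subset (hz.preimage_isClosed_of_isClosed isClosed_Icc isClosed_Ici)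
      inter_subset_left
  obtain ⟨m, hm, hmax⟩ := hcl.exists_isGreatest ⟨t, ht, hzt⟩
  have hm0 : 0 ≤ z m := hm.2
  have hmu : m < u := lt_of_le_of_ne hm.1.2 (by rintro rfl; linarith)
  have habove : ∀ s ∈ Ioc m u, z s < 0 := by
    intro s hs
    by_contra hh
    push Not at hh
    have := hmax ⟨⟨hm.1.1.trans hs.1.le, hs.2⟩, hh⟩
    linarith [hs.1]
  refine ⟨m, ⟨hm.1.1, hmu⟩, ?_, hmax ⟨ht, hzt⟩, habove⟩
  apply le_antisymm _ hm0
  have h1 : ContinuousWithinAt z (Ioc m u) m := (hz m hm.1).mono (fun x hx => ⟨hm.1.1.trans hx.1.le, hx.2⟩)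
  have : (nhdsWithin m (Ioc m u)).NeBot := by
    rw [← mem_closure_iff_nhdsWithin_neBot, closure_Ioc hmu.ne]; exact ⟨le_rfl, hmu.le⟩
  exact le_of_tendsto h1 (eventually_nhdsWithin_of_forall (fun s hs => (habove s hs).le))

/-- if z < z x on the right of x, derivative is nonpositive -/
lemma deriv_nonpos_of_right {z : ℝ → ℝ} {x d u : ℝ} (hxu : x < u) (hd : HasDerivAt z d x)
    (h : ∀ s ∈ Ioc x u, z s ≤ z x) : d ≤ 0 := by
  have h1 : Tendsto (slope z x) (nhdsWithin x (Ioi x)) (nhds d) :=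
    (hasDerivAt_iff_tendsto_slope.mp hd).mono_left (nhdsWithin_mono _ (fun y hy => ne_of_gt hy))
  refine le_of_tendsto h1 ?_
  filter_upwards [Ioc_mem_nhdsGT hxu] with y hy
  rw [slope_def_field]
  exact div_nonpos_of_nonpos_of_nonneg (by linarith [h y hy]) (by linarith [hy.1])

end PartF

section PartBranch

/-- Inverse branch of a solution, parametrised by the height `s`; `σ = 1` on the increasing
branch, `σ = -1` on the decreasing one; `p = |u'|`; dimension `n = m + 2`. -/
structure Br (σ : ℝ) (m : ℕ) (f : ℝ → ℝ) (U : ℝ) (r p : ℝ → ℝ) : Prop where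
  rpos : ∀ s ∈ Ioc 0 U, 0 < r s
  ppos : ∀ s ∈ Ioo 0 U, 0 < p s
  rc : ContinuousOn r (Ioc 0 U)
  pc : ContinuousOn p (Ioc 0 U)
  dr : ∀ s ∈ Ioo 0 U, HasDerivAt r (σ / p s) s
  dp : ∀ s ∈ Ioo 0 U, HasDerivAt p (-(σ * (m + 1) / r s) - f s / p s) s
  pU : p U = 0
  en : ∀ s ∈ Ioo 0 U, 0 < p s ^ 2 + 2 * Fint f s

/-- square root of twice the energy -/
noncomputable def wf (f p : ℝ → ℝ) (s : ℝ) : ℝ := Real.sqrt (p s ^ 2 + 2 * Fint f s)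

variable {σ : ℝ} {m : ℕ} {f : ℝ → ℝ} {U : ℝ} {r p : ℝ → ℝ}

lemma Br.wpos (b : Br σ m f U r p) {s : ℝ} (hs : s ∈ Ioo 0 U) : 0 < wf f p s :=
  Real.sqrt_pos.mpr (b.en s hs)

lemma Br.wsq (b : Br σ m f U r p) {s : ℝ} (hs : s ∈ Ioo 0 U) :
    wf f p s ^ 2 = p s ^ 2 + 2 * Fint f s :=
  Real.sq_sqrt (b.en s hs).le

lemma Br.dw (hf : ContinuousOn f (Ici 0)) (b : Br σ m f U r p) {s : ℝ} (hs : s ∈ Ioo 0 U) :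
    HasDerivAt (wf f p) (-(σ * (m + 1) * p s / (r s * wf f p s))) s := by
  have h1 := (((b.dp s hs).pow 2).add ((F_hasDerivAt hf hs.1).const_mul 2)).sqrt (b.en s hs).ne'
  have hw := b.wpos hs
  have hr := b.rpos s ⟨hs.1, hs.2.le⟩
  have hp := b.ppos s hs
  refine (h1.congr_deriv ?_)
  change _ / (2 * wf f p s) = _
  field_simp
  ring

/-- derivative of `r^(m+1) w` -/
lemma Br.dW (hf : ContinuousOn f (Ici 0)) (b : Br σ m f U r p)
    {s : ℝ} (hs : s ∈ Ioo 0 U) :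
    HasDerivAt (fun s => r s ^ (m + 1) * wf f p s)
      (σ * (m + 1) * r s ^ m * (2 * Fint f s) / (p s * wf f p s)) s := by
  have hw := b.wpos hs
  have hr := b.rpos s ⟨hs.1, hs.2.le⟩
  have hp := b.ppos s hs
  refine (((b.dr s hs).pow (m + 1)).mul (b.dw hf hs)).congr_deriv ?_
  have h2 : 2 * Fint f s = wf f p s ^ 2 - p s ^ 2 := by rw [b.wsq hs]; ring
  rw [h2]
  simp only [Nat.add_sub_cancel, Pi.pow_apply]
  push_cast
  field_simp
  ring

/-- derivative of `r w` -/
lemma Br.dY (hf : ContinuousOn f (Ici 0)) (b : Br (-1) m f U r p)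
    {s : ℝ} (hs : s ∈ Ioo 0 U) :
    HasDerivAt (fun s => r s * wf f p s)
      (m * (p s / wf f p s) + (-2 * Fint f s) / (p s * wf f p s)) s := by
  have hw := b.wpos hs
  have hr := b.rpos s ⟨hs.1, hs.2.le⟩
  have hp := b.ppos s hs
  refine ((b.dr s hs).mul (b.dw hf hs)).congr_deriv ?_
  have h2 : -2 * Fint f s = p s ^ 2 - wf f p s ^ 2 := by rw [b.wsq hs]; ring
  rw [h2]
  field_simp
  ring

/-- derivative of `v = r^(m+1) p` -/
lemma Br.dv (b : Br σ m f U r p) {s : ℝ} (hs : s ∈ Ioo 0 U) :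
    HasDerivAt (fun s => r s ^ (m + 1) * p s) (-(r s ^ (m + 1) * f s / p s)) s := by
  have hr := b.rpos s ⟨hs.1, hs.2.le⟩
  have hp := b.ppos s hs
  refine (((b.dr s hs).pow (m + 1)).mul (b.dp s hs)).congr_deriv ?_
  simp only [Nat.add_sub_cancel, Pi.pow_apply]
  push_cast
  field_simp
  ring

/-- the Erbe-Tang functional along a branch -/
noncomputable def Qf (σ : ℝ) (m : ℕ) (f r p : ℝ → ℝ) (s : ℝ) : ℝ :=
  σ * (2 * (m + 2)) * (Fint f s / f s) * (r s ^ (m + 1) * p s)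
    + r s ^ (m + 2) * (p s ^ 2 + 2 * Fint f s)

lemma Br.dQ (hf : ContinuousOn f (Ici 0)) (b : Br σ m f U r p)
    {s d : ℝ} (hs : s ∈ Ioo 0 U) (hfs : 0 < f s)
    (hd : HasDerivAt (fun t => Fint f t / f t) d s) :
    HasDerivAt (Qf σ m f r p)
      (σ * (r s ^ (m + 1) * p s) * (2 * (m + 2) * d - m)) s := by
  have hr := b.rpos s ⟨hs.1, hs.2.le⟩
  have hp := b.ppos s hs
  have h1 := ((hd.const_mul (σ * (2 * (m + 2)))).mul (b.dv hs)).add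
    (((b.dr s hs).pow (m + 2)).mul (((b.dp s hs).pow 2).add ((F_hasDerivAt hf hs.1).const_mul 2)))
  refine h1.congr_deriv ?_
  simp only [Pi.pow_apply, Pi.add_apply]
  push_cast
  field_simp
  ring

lemma wf_cont (hf : ContinuousOn f (Ici 0)) {S : Set ℝ} (hS : S ⊆ Ici 0)
    (hp : ContinuousOn p S) : ContinuousOn (wf f p) S := by
  unfold wf
  exact (((hp.pow 2).add (((F_cont hf).mono hS).const_mul 2))).sqrt

end PartBranch

section PartLeft

variable {m : ℕ} {f : ℝ → ℝ} {β B U₁ U₂ : ℝ} {r₁ p₁ r₂ p₂ : ℝ → ℝ}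

/-- `r₁ - r₂` is monotone on a left-type comparison interval. -/
lemma left_r (b₁ : Br 1 m f U₁ r₁ p₁) (b₂ : Br 1 m f U₂ r₂ p₂) {l t : ℝ} (hl : 0 ≤ l) (hlt : l ≤ t)
    (c₁ : ContinuousOn r₁ (Icc l t)) (c₂ : ContinuousOn r₂ (Icc l t))
    (h₁ : t ≤ U₁) (h₂ : t ≤ U₂) (hz : ∀ s ∈ Ico l t, p₁ s < p₂ s) (h0 : r₂ l ≤ r₁ l) :
    r₂ t ≤ r₁ t := by
  have := mono_of_hd (g := fun s => r₁ s - r₂ s) (g' := fun s => 1 / p₁ s - 1 / p₂ s) hlt (c₁.sub c₂)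
    (fun x hx => (b₁.dr x ⟨hl.trans_lt hx.1, hx.2.trans_le h₁⟩).sub
      (b₂.dr x ⟨hl.trans_lt hx.1, hx.2.trans_le h₂⟩))
    (fun x hx => by
      have := b₁.ppos x ⟨hl.trans_lt hx.1, hx.2.trans_le h₁⟩
      have := one_div_le_one_div_of_le this (hz x ⟨hx.1.le, hx.2⟩).le
      linarith)
  linarith

lemma left_low (hf : ContinuousOn f (Ici 0)) (h2 : CondF2B f β B)
    (b₁ : Br 1 m f U₁ r₁ p₁) (b₂ : Br 1 m f U₂ r₂ p₂)
    (hβ₁ : β < U₁) (hβ₂ : β < U₂)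
    (cr₁ : ContinuousOn r₁ (Icc 0 U₁)) (cr₂ : ContinuousOn r₂ (Icc 0 U₂))
    (cp₁ : ContinuousOn p₁ (Icc 0 U₁)) (cp₂ : ContinuousOn p₂ (Icc 0 U₂))
    (h0 : r₁ 0 = r₂ 0) (ha : 0 < r₁ 0) (hp0 : 0 < p₁ 0) (hlt : p₁ 0 < p₂ 0) :
    r₂ β ≤ r₁ β ∧ r₁ β ^ (m + 1) * p₁ β < r₂ β ^ (m + 1) * p₂ β := by
  have hβ : 0 < β := h2.2.1.trans h2.2.2.1
  have sub₁ : ∀ t ≤ β, Icc 0 t ⊆ Icc 0 U₁ := fun t ht x hx => ⟨hx.1, by linarith [hx.2]⟩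
  have sub₂ : ∀ t ≤ β, Icc 0 t ⊆ Icc 0 U₂ := fun t ht x hx => ⟨hx.1, by linarith [hx.2]⟩
  have hw0 : ∀ p : ℝ → ℝ, 0 < p 0 → wf f p 0 = p 0 := by
    intro p hp
    simp [wf, F_zero, Real.sqrt_sq hp.le]
  have hr0 : 0 < r₂ 0 := h0 ▸ ha
  have hp20 : 0 < p₂ 0 := hp0.trans hlt
  have key : ∀ t ∈ Icc 0 β, (∀ s ∈ Ico 0 t, p₁ s < p₂ s) →
      r₂ t ≤ r₁ t ∧ r₁ t ^ (m + 1) * wf f p₁ t < r₂ t ^ (m + 1) * wf f p₂ t := by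
    intro t ht hz
    have hrr : ∀ x ∈ Icc 0 t, r₂ x ≤ r₁ x := fun x hx =>
      left_r b₁ b₂ le_rfl hx.1 (cr₁.mono (sub₁ x (hx.2.trans ht.2))) (cr₂.mono (sub₂ x (hx.2.trans ht.2)))
        (by linarith [hx.2, ht.2]) (by linarith [hx.2, ht.2])
        (fun s hs => hz s ⟨hs.1, by linarith [hs.2, hx.2]⟩) h0.ge
    refine ⟨hrr t ⟨ht.1, le_rfl⟩, ?_⟩
    have cw₁ : ContinuousOn (wf f p₁) (Icc 0 t) := wf_cont hf (fun x hx => hx.1) (cp₁.mono (sub₁ t ht.2))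
    have cw₂ : ContinuousOn (wf f p₂) (Icc 0 t) := wf_cont hf (fun x hx => hx.1) (cp₂.mono (sub₂ t ht.2))
    have := anti_of_hd
      (g := fun s => r₁ s ^ (m + 1) * wf f p₁ s - r₂ s ^ (m + 1) * wf f p₂ s)
      (g' := fun s => 1 * (m + 1) * r₁ s ^ m * (2 * Fint f s) / (p₁ s * wf f p₁ s)
        - 1 * (m + 1) * r₂ s ^ m * (2 * Fint f s) / (p₂ s * wf f p₂ s)) ht.1
      ((((cr₁.mono (sub₁ t ht.2)).pow _).mul cw₁).sub (((cr₂.mono (sub₂ t ht.2)).pow _).mul cw₂))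
      (fun x hx => (b₁.dW hf ⟨hx.1, by linarith [hx.2, ht.2]⟩).sub
        (b₂.dW hf ⟨hx.1, by linarith [hx.2, ht.2]⟩))
      (fun x hx => by
        have x1 : x ∈ Ioo 0 U₁ := ⟨hx.1, by linarith [hx.2, ht.2]⟩
        have x2 : x ∈ Ioo 0 U₂ := ⟨hx.1, by linarith [hx.2, ht.2]⟩
        have hzx := hz x ⟨hx.1.le, hx.2⟩
        have hrx := hrr x ⟨hx.1.le, hx.2.le⟩
        have hF := F_nonpos hf h2 (s := x) ⟨hx.1.le, by linarith [hx.2, ht.2]⟩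
        have hw1 := b₁.wpos x1
        have hw2 := b₂.wpos x2
        have hp1 := b₁.ppos x x1
        have hp2 := b₂.ppos x x2
        have hr2 := b₂.rpos x ⟨x2.1, x2.2.le⟩
        have hr1 : 0 < r₁ x := by linarith
        have hww : wf f p₁ x ≤ wf f p₂ x := by
          unfold wf; apply Real.sqrt_le_sqrt; nlinarith
        have : r₂ x ^ m / (p₂ x * wf f p₂ x) ≤ r₁ x ^ m / (p₁ x * wf f p₁ x) := by
          apply div_le_div₀ (by positivity) (by gcongr) (by positivity) (by gcongr)
        have e : ∀ A C : ℝ, 1 * ((m:ℝ) + 1) * A * (2 * Fint f x) / C = (A / C) * (((m:ℝ) + 1) * (2 * Fint f x)) := by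
          intro A C; ring
        rw [e, e, ← sub_mul]
        apply mul_nonpos_of_nonneg_of_nonpos (by linarith)
        apply mul_nonpos_of_nonneg_of_nonpos (by positivity) (by linarith))
    simp only [hw0 p₁ hp0, hw0 p₂ hp20] at this
    rw [h0] at this
    have : r₂ 0 ^ (m + 1) * p₁ 0 < r₂ 0 ^ (m + 1) * p₂ 0 := by gcongr
    linarith
  have hall : ∀ t ∈ Icc 0 β, p₁ t - p₂ t < 0 := by
    refine boot_up (z := fun t => p₁ t - p₂ t) ((cp₁.mono (sub₁ β le_rfl)).sub (cp₂.mono (sub₂ β le_rfl))) ?_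
    intro t ht hz
    obtain ⟨h3, h4⟩ := key t ht (fun s hs => by linarith [hz s hs])
    rcases ht.1.eq_or_lt with h5 | h5
    · subst h5; linarith
    · have x1 : t ∈ Ioo 0 U₁ := ⟨h5, by linarith [ht.2]⟩
      have x2 : t ∈ Ioo 0 U₂ := ⟨h5, by linarith [ht.2]⟩
      by_contra hcon
      have hpp : p₂ t ≤ p₁ t := by linarith
      have hp2 := b₂.ppos t x2
      have hww : wf f p₂ t ≤ wf f p₁ t := by
        unfold wf; apply Real.sqrt_le_sqrt; nlinarith
      have hr2 := b₂.rpos t ⟨x2.1, x2.2.le⟩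
      have hr1 : 0 < r₁ t := by linarith
      have hw2 := b₂.wpos x2
      have : r₂ t ^ (m + 1) * wf f p₂ t ≤ r₁ t ^ (m + 1) * wf f p₁ t := by gcongr
      linarith
  obtain ⟨h3, h4⟩ := key β ⟨hβ.le, le_rfl⟩ (fun s hs => by linarith [hall s ⟨hs.1, hs.2.le⟩])
  refine ⟨h3, ?_⟩
  have hFβ : Fint f β = 0 := h2.2.2.2.2.2.2
  have e : ∀ p : ℝ → ℝ, 0 < p β → wf f p β = p β := by
    intro p hp
    simp [wf, hFβ, Real.sqrt_sq hp.le]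
  rwa [e p₁ (b₁.ppos β ⟨hβ, hβ₁⟩), e p₂ (b₂.ppos β ⟨hβ, hβ₂⟩)] at h4

lemma left_high (h2 : CondF2B f β B)
    (b₁ : Br 1 m f U₁ r₁ p₁) (b₂ : Br 1 m f U₂ r₂ p₂)
    (hβ₁ : β < U₁) (hβ₂ : β < U₂)
    (h3 : r₂ β ≤ r₁ β) (h4 : r₁ β ^ (m + 1) * p₁ β < r₂ β ^ (m + 1) * p₂ β) :
    U₁ < U₂ ∧ ∀ t ∈ Icc β U₁, r₁ t ^ (m + 1) * p₁ t < r₂ t ^ (m + 1) * p₂ t := by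
  have hβ : 0 < β := h2.2.1.trans h2.2.2.1
  have sub₁ : ∀ t ≤ min U₁ U₂, Icc β t ⊆ Ioc 0 U₁ := fun t ht x hx =>
    ⟨hβ.trans_le hx.1, hx.2.trans (ht.trans (min_le_left _ _))⟩
  have sub₂ : ∀ t ≤ min U₁ U₂, Icc β t ⊆ Ioc 0 U₂ := fun t ht x hx =>
    ⟨hβ.trans_le hx.1, hx.2.trans (ht.trans (min_le_right _ _))⟩
  have key : ∀ t ∈ Icc β (min U₁ U₂), (∀ s ∈ Ico β t, p₁ s < p₂ s) →
      r₂ t ≤ r₁ t ∧ r₁ t ^ (m + 1) * p₁ t < r₂ t ^ (m + 1) * p₂ t := by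
    intro t ht hz
    have hrr : ∀ x ∈ Icc β t, r₂ x ≤ r₁ x := fun x hx =>
      left_r b₁ b₂ hβ.le hx.1 (b₁.rc.mono (sub₁ x (hx.2.trans ht.2))) (b₂.rc.mono (sub₂ x (hx.2.trans ht.2)))
        ((hx.2.trans ht.2).trans (min_le_left _ _)) ((hx.2.trans ht.2).trans (min_le_right _ _))
        (fun s hs => hz s ⟨hs.1, by linarith [hs.2, hx.2]⟩) h3
    refine ⟨hrr t ⟨ht.1, le_rfl⟩, ?_⟩
    have := anti_of_hd
      (g := fun s => r₁ s ^ (m + 1) * p₁ s - r₂ s ^ (m + 1) * p₂ s)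
      (g' := fun s => -(r₁ s ^ (m + 1) * f s / p₁ s) - -(r₂ s ^ (m + 1) * f s / p₂ s)) ht.1
      ((((b₁.rc.mono (sub₁ t ht.2)).pow _).mul (b₁.pc.mono (sub₁ t ht.2))).sub
        (((b₂.rc.mono (sub₂ t ht.2)).pow _).mul (b₂.pc.mono (sub₂ t ht.2))))
      (fun x hx => (b₁.dv ⟨hβ.trans hx.1, hx.2.trans_le (ht.2.trans (min_le_left _ _))⟩).sub
        (b₂.dv ⟨hβ.trans hx.1, hx.2.trans_le (ht.2.trans (min_le_right _ _))⟩))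
      (fun x hx => by
        have x1 : x ∈ Ioo 0 U₁ := ⟨hβ.trans hx.1, hx.2.trans_le (ht.2.trans (min_le_left _ _))⟩
        have x2 : x ∈ Ioo 0 U₂ := ⟨hβ.trans hx.1, hx.2.trans_le (ht.2.trans (min_le_right _ _))⟩
        have hzx := hz x ⟨hx.1.le, hx.2⟩
        have hrx := hrr x ⟨hx.1.le, hx.2.le⟩
        have hfx := h2.2.2.2.1 x (h2.2.2.1.trans hx.1)
        have hp1 := b₁.ppos x x1
        have hr2 := b₂.rpos x ⟨x2.1, x2.2.le⟩
        have hr1 : 0 < r₁ x := by linarith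
        have : r₂ x ^ (m+1) * f x / p₂ x ≤ r₁ x ^ (m+1) * f x / p₁ x := by gcongr
        linarith)
    linarith
  have hall : ∀ t ∈ Icc β (min U₁ U₂), r₁ t ^ (m + 1) * p₁ t - r₂ t ^ (m + 1) * p₂ t < 0 := by
    refine boot_up (z := fun t => r₁ t ^ (m + 1) * p₁ t - r₂ t ^ (m + 1) * p₂ t) ((((b₁.rc.mono (sub₁ _ le_rfl)).pow _).mul (b₁.pc.mono (sub₁ _ le_rfl))).sub
        (((b₂.rc.mono (sub₂ _ le_rfl)).pow _).mul (b₂.pc.mono (sub₂ _ le_rfl)))) ?_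
    intro t ht hz
    have hzp : ∀ t' ∈ Icc β t, (∀ s ∈ Ico β t', p₁ s - p₂ s < 0) → t' < t → p₁ t' - p₂ t' < 0 := by
      intro t' ht' hs' hlt
      have ht2 := ht'.2.trans ht.2
      obtain ⟨h5, h6⟩ := key t' ⟨ht'.1, ht2⟩ (fun s hs => by linarith [hs' s hs])
      by_contra hcon
      have x2 : t' ∈ Ioo 0 U₂ := ⟨hβ.trans_le ht'.1, hlt.trans_le (ht.2.trans (min_le_right _ _))⟩
      have hr2 := b₂.rpos t' ⟨x2.1, x2.2.le⟩
      have hr1 : 0 < r₁ t' := by linarith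
      have hp2 := b₂.ppos t' x2
      have : p₂ t' ≤ p₁ t' := by linarith
      have : r₂ t' ^ (m + 1) * p₂ t' ≤ r₁ t' ^ (m + 1) * p₁ t' := by gcongr
      linarith
    have hp : ∀ s ∈ Ico β t, p₁ s < p₂ s := by
      intro s hs
      have := boot_up (z := fun s => p₁ s - p₂ s) (l := β) (u := s)
        ((b₁.pc.mono (sub₁ _ (hs.2.le.trans ht.2))).sub (b₂.pc.mono (sub₂ _ (hs.2.le.trans ht.2))))
        (fun t' ht' hh => hzp t' ⟨ht'.1, ht'.2.trans hs.2.le⟩ hh (ht'.2.trans_lt hs.2)) s ⟨hs.1, le_rfl⟩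
      linarith
    linarith [(key t ht hp).2]
  have hU : U₁ < U₂ := by
    by_contra hcon
    have hm : min U₁ U₂ = U₂ := min_eq_right (not_lt.mp hcon)
    rw [hm] at hall
    have h5 := hall U₂ ⟨hβ₂.le, le_rfl⟩
    rw [b₂.pU] at h5
    have hr := b₁.rpos U₂ ⟨hβ.trans hβ₂, not_lt.mp hcon⟩
    have hp : 0 ≤ p₁ U₂ := by
      rcases (not_lt.mp hcon).eq_or_lt with h | h
      · rw [h, b₁.pU]
      · exact (b₁.ppos U₂ ⟨hβ.trans hβ₂, h⟩).le
    have : 0 ≤ r₁ U₂ ^ (m + 1) * p₁ U₂ := by positivity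
    linarith
  refine ⟨hU, fun t ht => ?_⟩
  have := hall t (by rwa [min_eq_left hU.le])
  linarith

end PartLeft

section PartRight

variable {m : ℕ} {f : ℝ → ℝ} {β B U₁ U₂ : ℝ} {r₁ p₁ r₂ p₂ : ℝ → ℝ}

/-- `r |u'|` is not bounded below near infinity -/
def NoDecay (r p : ℝ → ℝ) : Prop := ∀ c > 0, ∀ s₁ > 0, ∃ s ∈ Ioo 0 s₁, r s * p s < c

lemma right1 (hf : ContinuousOn f (Ici 0)) (h2 : CondF2B f β B)
    (b₁ : Br (-1) m f U₁ r₁ p₁) (b₂ : Br (-1) m f U₂ r₂ p₂)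
    (hβ₁ : β < U₁) (hβ₂ : β < U₂) (N : NoDecay r₂ p₂) {t : ℝ} (ht : t ∈ Ioc 0 β)
    (hr : r₂ t ≤ r₁ t) : r₂ t * wf f p₂ t ≤ r₁ t * wf f p₁ t := by
  by_contra hcon
  push Not at hcon
  have i₁ : ∀ x ∈ Ioc 0 t, x ∈ Ioo 0 U₁ := fun x hx => ⟨hx.1, by linarith [hx.2, ht.2]⟩
  have i₂ : ∀ x ∈ Ioc 0 t, x ∈ Ioo 0 U₂ := fun x hx => ⟨hx.1, by linarith [hx.2, ht.2]⟩
  have sub₁ : ∀ x > 0, Icc x t ⊆ Ioc 0 U₁ := fun x hx y hy => ⟨hx.trans_le hy.1, by linarith [hy.2, ht.2]⟩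
  have sub₂ : ∀ x > 0, Icc x t ⊆ Ioc 0 U₂ := fun x hx y hy => ⟨hx.trans_le hy.1, by linarith [hy.2, ht.2]⟩
  have keyr : ∀ x ∈ Ioc 0 t, (∀ s ∈ Ioc x t, p₁ s < p₂ s) → r₂ x ≤ r₁ x := by
    intro x hx hz
    have := anti_of_hd (g := fun s => r₁ s - r₂ s) (g' := fun s => -1 / p₁ s - -1 / p₂ s) hx.2
      ((b₁.rc.mono (sub₁ x hx.1)).sub (b₂.rc.mono (sub₂ x hx.1)))
      (fun y hy => (b₁.dr y (i₁ y ⟨hx.1.trans hy.1, hy.2.le⟩)).sub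
        (b₂.dr y (i₂ y ⟨hx.1.trans hy.1, hy.2.le⟩)))
      (fun y hy => by
        have := b₁.ppos y (i₁ y ⟨hx.1.trans hy.1, hy.2.le⟩)
        have := one_div_le_one_div_of_le this (hz y ⟨hy.1, hy.2.le⟩).le
        have e : ∀ A : ℝ, -1 / A = -(1 / A) := fun A => by ring
        rw [e, e]
        linarith)
    linarith
  have key : ∀ x ∈ Ioc 0 t, (∀ s ∈ Ioc x t, p₁ s < p₂ s) → r₂ x ≤ r₁ x ∧
      r₁ x * wf f p₁ x - r₂ x * wf f p₂ x ≤ r₁ t * wf f p₁ t - r₂ t * wf f p₂ t := by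
    intro x hx hz
    refine ⟨keyr x hx hz, ?_⟩
    have pos : ∀ y, y ∈ Ici x → y ∈ Ici (0:ℝ) := fun y hy => hx.1.le.trans hy
    refine mono_of_hd (g := fun s => r₁ s * wf f p₁ s - r₂ s * wf f p₂ s)
      (g' := fun s => (m * (p₁ s / wf f p₁ s) + (-2 * Fint f s) / (p₁ s * wf f p₁ s))
        - (m * (p₂ s / wf f p₂ s) + (-2 * Fint f s) / (p₂ s * wf f p₂ s))) hx.2
      (((b₁.rc.mono (sub₁ x hx.1)).mul (wf_cont hf (fun y hy => pos y hy.1) (b₁.pc.mono (sub₁ x hx.1)))).sub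
        ((b₂.rc.mono (sub₂ x hx.1)).mul (wf_cont hf (fun y hy => pos y hy.1) (b₂.pc.mono (sub₂ x hx.1)))))
      (fun y hy => (b₁.dY hf (i₁ y ⟨hx.1.trans hy.1, hy.2.le⟩)).sub
        (b₂.dY hf (i₂ y ⟨hx.1.trans hy.1, hy.2.le⟩))) ?_
    intro y hy
    have y0 : y ∈ Ioc 0 t := ⟨hx.1.trans hy.1, hy.2.le⟩
    have hF := F_nonpos hf h2 (s := y) ⟨y0.1.le, y0.2.trans ht.2⟩
    have hw1 := b₁.wpos (i₁ y y0)
    have hw2 := b₂.wpos (i₂ y y0)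
    have hp1 := b₁.ppos y (i₁ y y0)
    have hp2 := b₂.ppos y (i₂ y y0)
    have hs1 := b₁.wsq (i₁ y y0)
    have hs2 := b₂.wsq (i₂ y y0)
    have hz' := hz y ⟨hy.1, hy.2.le⟩
    have hww : wf f p₁ y ≤ wf f p₂ y := by
      unfold wf; apply Real.sqrt_le_sqrt; nlinarith
    have a1 : p₂ y / wf f p₂ y ≤ p₁ y / wf f p₁ y := by
      rw [div_le_div_iff₀ hw2 hw1]
      apply le_of_sq_le_sq _ (by positivity)
      rw [mul_pow, mul_pow, hs1, hs2]
      nlinarith [mul_nonneg (by linarith : 0 ≤ -2 * Fint f y) (by nlinarith : 0 ≤ p₂ y ^ 2 - p₁ y ^ 2)]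
    have a2 : (-2 * Fint f y) / (p₂ y * wf f p₂ y) ≤ (-2 * Fint f y) / (p₁ y * wf f p₁ y) := by
      apply div_le_div_of_nonneg_left (by linarith) (by positivity) (by gcongr)
    have a3 : (m:ℝ) * (p₂ y / wf f p₂ y) ≤ m * (p₁ y / wf f p₁ y) := by gcongr
    linarith
  have hall : ∀ x ∈ Ioc 0 t, p₁ x < p₂ x := by
    intro x hx
    have := boot_down (z := fun s => p₁ s - p₂ s) (l := x) (u := t)
      ((b₁.pc.mono (sub₁ x hx.1)).sub (b₂.pc.mono (sub₂ x hx.1)))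
      (fun y hy hz => by
        have y0 : y ∈ Ioc 0 t := ⟨hx.1.trans_le hy.1, hy.2⟩
        obtain ⟨h3, h4⟩ := key y y0 (fun s hs => by linarith [hz s hs])
        by_contra hc
        have hw2 := b₂.wpos (i₂ y y0)
        have hp2 := b₂.ppos y (i₂ y y0)
        have hr2 := b₂.rpos y ⟨y0.1, (i₂ y y0).2.le⟩
        have hpp : p₂ y ≤ p₁ y := by linarith
        have hww : wf f p₂ y ≤ wf f p₁ y := by
          unfold wf; apply Real.sqrt_le_sqrt; nlinarith
        have hr1 : 0 < r₁ y := by linarith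
        have : r₂ y * wf f p₂ y ≤ r₁ y * wf f p₁ y := by gcongr
        linarith) x ⟨le_rfl, hx.2⟩
    linarith
  obtain ⟨s, hs, hsc⟩ := N (r₂ t * wf f p₂ t - r₁ t * wf f p₁ t) (by linarith) t ht.1
  have s0 : s ∈ Ioc 0 t := ⟨hs.1, hs.2.le⟩
  have h5 := (key s s0 (fun y hy => hall y ⟨hs.1.trans hy.1, hy.2⟩)).2
  have hw1 := b₁.wpos (i₁ s s0)
  have hr1 := b₁.rpos s ⟨s0.1, (i₁ s s0).2.le⟩
  have hr2 := b₂.rpos s ⟨s0.1, (i₂ s s0).2.le⟩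
  have hF := F_nonpos hf h2 (s := s) ⟨s0.1.le, s0.2.trans ht.2⟩
  have hwp : wf f p₂ s ≤ p₂ s := by
    rw [← Real.sqrt_sq (b₂.ppos s (i₂ s s0)).le]
    unfold wf; apply Real.sqrt_le_sqrt; linarith
  have : r₂ s * wf f p₂ s ≤ r₂ s * p₂ s := by gcongr
  have : 0 < r₁ s * wf f p₁ s := by positivity
  linarith

lemma right2 (hf : ContinuousOn f (Ici 0)) (h2 : CondF2B f β B)
    (b₁ : Br (-1) m f U₁ r₁ p₁) (b₂ : Br (-1) m f U₂ r₂ p₂)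
    (hβ₁ : β < U₁) (hβ₂ : β < U₂) (N : NoDecay r₂ p₂) {a : ℝ} (ha : 0 < a)
    (hra : ∀ s ∈ Ioc 0 U₂, a ≤ r₂ s) (hp : p₁ β < p₂ β) : r₂ β ≤ r₁ β := by
  have hβ : 0 < β := h2.2.1.trans h2.2.2.1
  by_contra hcon
  push Not at hcon
  have i₁ : ∀ x ∈ Ioc 0 β, x ∈ Ioo 0 U₁ := fun x hx => ⟨hx.1, by linarith [hx.2]⟩
  have i₂ : ∀ x ∈ Ioc 0 β, x ∈ Ioo 0 U₂ := fun x hx => ⟨hx.1, by linarith [hx.2]⟩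
  have sub₁ : ∀ x > 0, Icc x β ⊆ Ioc 0 U₁ := fun x hx y hy => ⟨hx.trans_le hy.1, by linarith [hy.2]⟩
  have sub₂ : ∀ x > 0, Icc x β ⊆ Ioc 0 U₂ := fun x hx y hy => ⟨hx.trans_le hy.1, by linarith [hy.2]⟩
  have hall : ∀ x ∈ Ioc 0 β, max (p₁ x - p₂ x) (r₁ x - r₂ x) < 0 := by
    intro x hx
    have cp := (b₁.pc.mono (sub₁ x hx.1)).sub (b₂.pc.mono (sub₂ x hx.1))
    have cr := (b₁.rc.mono (sub₁ x hx.1)).sub (b₂.rc.mono (sub₂ x hx.1))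
    refine boot_down (z := fun x => max (p₁ x - p₂ x) (r₁ x - r₂ x)) (l := x) (u := β)
      (cp.sup cr) ?_ x ⟨le_rfl, hx.2⟩
    intro t ht hz
    have t0 : t ∈ Ioc 0 β := ⟨hx.1.trans_le ht.1, ht.2⟩
    have hzp : ∀ s ∈ Ioc t β, p₁ s < p₂ s := fun s hs => by
      linarith [(le_max_left _ _).trans_lt (hz s hs)]
    have hzr : ∀ s ∈ Ioc t β, r₁ s < r₂ s := fun s hs => by
      linarith [(le_max_right _ _).trans_lt (hz s hs)]
    have ppt : p₁ t < p₂ t := by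
      have cC : ContinuousOn (fun s => f s / (p₁ s * p₂ s)) (Icc t β) := by
        apply ContinuousOn.div (hf.mono (fun y hy => t0.1.le.trans hy.1))
          ((b₁.pc.mono (sub₁ t t0.1)).mul (b₂.pc.mono (sub₂ t t0.1)))
        intro y hy
        have y0 : y ∈ Ioc 0 β := ⟨t0.1.trans_le hy.1, hy.2⟩
        exact (mul_pos (b₁.ppos y (i₁ y y0)) (b₂.ppos y (i₂ y y0))).ne'
      obtain ⟨C, hC⟩ := isCompact_Icc.bddAbove_image cC
      have hC' : ∀ y ∈ Icc t β, f y / (p₁ y * p₂ y) ≤ C := fun y hy => hC ⟨y, hy, rfl⟩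
      have := mono_of_hd (g := fun s => (p₁ s - p₂ s) * Real.exp (-C * s))
        (g' := fun s => ((-(-1 * (m + 1) / r₁ s) - f s / p₁ s) - (-(-1 * (m + 1) / r₂ s) - f s / p₂ s)) * Real.exp (-C * s)
          + (p₁ s - p₂ s) * (Real.exp (-C * s) * (-C * 1))) ht.2
        (((b₁.pc.mono (sub₁ t t0.1)).sub (b₂.pc.mono (sub₂ t t0.1))).mul (by fun_prop))
        (fun y hy => by
          have y0 : y ∈ Ioc 0 β := ⟨t0.1.trans hy.1, hy.2.le⟩
          exact ((b₁.dp y (i₁ y y0)).sub (b₂.dp y (i₂ y y0))).mul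
            (((hasDerivAt_id y).const_mul (-C)).exp))
        (fun y hy => by
          have y0 : y ∈ Ioc 0 β := ⟨t0.1.trans hy.1, hy.2.le⟩
          have hp1 := b₁.ppos y (i₁ y y0)
          have hp2 := b₂.ppos y (i₂ y y0)
          have hr1 := b₁.rpos y ⟨y0.1, (i₁ y y0).2.le⟩
          have hr2 := b₂.rpos y ⟨y0.1, (i₂ y y0).2.le⟩
          have h1 : 1 / r₂ y ≤ 1 / r₁ y := one_div_le_one_div_of_le hr1 (hzr y ⟨hy.1, hy.2.le⟩).le
          have h3 := hC' y ⟨hy.1.le, hy.2.le⟩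
          have h4 := hzp y ⟨hy.1, hy.2.le⟩
          have e : ((-(-1 * ((m:ℝ) + 1) / r₁ y) - f y / p₁ y) - (-(-1 * ((m:ℝ) + 1) / r₂ y) - f y / p₂ y)) * Real.exp (-C * y)
            + (p₁ y - p₂ y) * (Real.exp (-C * y) * (-C * 1))
            = (((m:ℝ) + 1) * (1 / r₁ y - 1 / r₂ y) + (p₂ y - p₁ y) * (C - f y / (p₁ y * p₂ y))) * Real.exp (-C * y) := by
            field_simp
            ring
          rw [e]
          apply mul_nonneg _ (Real.exp_pos _).le
          have h5 : 0 ≤ (p₂ y - p₁ y) * (C - f y / (p₁ y * p₂ y)) := mul_nonneg (by linarith) (by linarith)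
          have h6 : 0 ≤ ((m:ℝ) + 1) * (1 / r₁ y - 1 / r₂ y) := mul_nonneg (by positivity) (by linarith)
          linarith)
      have h7 : (p₁ β - p₂ β) * Real.exp (-C * β) < 0 := mul_neg_of_neg_of_pos (by linarith) (Real.exp_pos _)
      have h8 : (p₁ t - p₂ t) * Real.exp (-C * t) < 0 := this.trans_lt h7
      have := neg_of_mul_neg_left h8 (Real.exp_pos _).le
      linarith
    refine max_lt (by linarith) ?_
    by_contra hc
    have hr : r₂ t ≤ r₁ t := by linarith
    have h3 := right1 hf h2 b₁ b₂ hβ₁ hβ₂ N t0 hr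
    have hr' : r₁ t ≤ r₂ t := by
      rcases ht.2.eq_or_lt with h | h
      · rw [h]; exact hcon.le
      · have c1 : ContinuousWithinAt (fun x => r₁ x - r₂ x) (Ioc t β) t :=
          (cr t ht).mono (fun y hy => ⟨ht.1.trans hy.1.le, hy.2⟩)
        have : (nhdsWithin t (Ioc t β)).NeBot := by
          rw [← mem_closure_iff_nhdsWithin_neBot, closure_Ioc h.ne]; exact ⟨le_rfl, h.le⟩
        have := le_of_tendsto (b := 0) c1 (eventually_nhdsWithin_of_forall (fun s hs => by
          linarith [hzr s hs]))
        linarith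
    have hre : r₁ t = r₂ t := le_antisymm hr' hr
    rw [hre] at h3
    have hr2 := b₂.rpos t ⟨t0.1, (i₂ t t0).2.le⟩
    have h4 : wf f p₂ t ≤ wf f p₁ t := le_of_mul_le_mul_left h3 hr2
    have h5 := b₁.wsq (i₁ t t0)
    have h6 := b₂.wsq (i₂ t t0)
    have h7 := b₂.wpos (i₂ t t0)
    have h8 := b₁.ppos t (i₁ t t0)
    nlinarith
  have hB : 0 < B := h2.2.1
  have hBβ : B < β := h2.2.2.1
  have B0 : B ∈ Ioc 0 β := ⟨hB, hBβ.le⟩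
  have hc : 0 < p₂ B - p₁ B := by
    linarith [(le_max_left _ _).trans_lt (hall B B0)]
  obtain ⟨s, hs, hsc⟩ := N (a * (p₂ B - p₁ B)) (by positivity) B hB
  have s0 : s ∈ Ioc 0 β := ⟨hs.1, hs.2.le.trans hBβ.le⟩
  have := mono_of_hd (g := fun s => p₁ s - p₂ s)
    (g' := fun s => (-(-1 * (m + 1) / r₁ s) - f s / p₁ s) - (-(-1 * (m + 1) / r₂ s) - f s / p₂ s)) hs.2.le
    ((b₁.pc.mono ((Icc_subset_Icc_right hBβ.le).trans (sub₁ s hs.1))).sub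
      (b₂.pc.mono ((Icc_subset_Icc_right hBβ.le).trans (sub₂ s hs.1))))
    (fun y hy => by
      have y0 : y ∈ Ioc 0 β := ⟨hs.1.trans hy.1, hy.2.le.trans hBβ.le⟩
      exact ((b₁.dp y (i₁ y y0)).sub (b₂.dp y (i₂ y y0))))
    (fun y hy => by
      have y0 : y ∈ Ioc 0 β := ⟨hs.1.trans hy.1, hy.2.le.trans hBβ.le⟩
      have hp1 := b₁.ppos y (i₁ y y0)
      have hp2 := b₂.ppos y (i₂ y y0)
      have hr1 := b₁.rpos y ⟨y0.1, (i₁ y y0).2.le⟩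
      have hr2 := b₂.rpos y ⟨y0.1, (i₂ y y0).2.le⟩
      have h1 : 1 / r₂ y ≤ 1 / r₁ y := one_div_le_one_div_of_le hr1
        (by linarith [(le_max_right _ _).trans_lt (hall y y0)])
      have h3 : 1 / p₂ y ≤ 1 / p₁ y := one_div_le_one_div_of_le hp1
        (by linarith [(le_max_left _ _).trans_lt (hall y y0)])
      have hfy := h2.2.2.2.2.1 y ⟨y0.1.le, hy.2.le⟩
      have e : ((-(-1 * ((m:ℝ) + 1) / r₁ y) - f y / p₁ y) - (-(-1 * ((m:ℝ) + 1) / r₂ y) - f y / p₂ y))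
        = ((m:ℝ) + 1) * (1 / r₁ y - 1 / r₂ y) + (-f y) * (1 / p₁ y - 1 / p₂ y) := by ring
      rw [e]
      have h5 : 0 ≤ (-f y) * (1 / p₁ y - 1 / p₂ y) := mul_nonneg (by linarith) (by linarith)
      have h6 : 0 ≤ ((m:ℝ) + 1) * (1 / r₁ y - 1 / r₂ y) := mul_nonneg (by positivity) (by linarith)
      linarith)
  have hp1 := b₁.ppos s (i₁ s s0)
  have hrs := hra s ⟨s0.1, (i₂ s s0).2.le⟩
  have h9 : p₂ B - p₁ B ≤ p₂ s := by linarith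
  have : a * (p₂ B - p₁ B) ≤ r₂ s * p₂ s := mul_le_mul hrs h9 hc.le (by linarith)
  linarith

end PartRight

section PartCore

variable {m : ℕ} {f : ℝ → ℝ} {β B U U₁ U₂ σ : ℝ} {t₁ q₁ t₂ q₂ r₁ p₁ r₂ p₂ r p : ℝ → ℝ}

lemma Qcont (hf : ContinuousOn f (Ici 0)) (h2 : CondF2B f β B) (b : Br σ m f U r p) :
    ContinuousOn (Qf σ m f r p) (Icc β U) := by
  have hβ : 0 < β := h2.2.1.trans h2.2.2.1
  have s1 : Icc β U ⊆ Ioc 0 U := fun x hx => ⟨hβ.trans_le hx.1, hx.2⟩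
  have s2 : Icc β U ⊆ Ici 0 := fun x hx => hβ.le.trans hx.1
  have cF := (F_cont hf).mono s2
  have cf := hf.mono s2
  have cr := b.rc.mono s1
  have cp := b.pc.mono s1
  unfold Qf
  refine ((continuousOn_const.mul (cF.div cf ?_)).mul ((cr.pow _).mul cp)).add
    ((cr.pow _).mul ((cp.pow 2).add (continuousOn_const.mul cF)))
  intro x hx
  exact (h2.2.2.2.1 x (h2.2.2.1.trans_le hx.1)).ne'

lemma core (hf : ContinuousOn f (Ici 0)) (h2 : CondF2B f β B) (h3 : CondF3 (m + 2) f β)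
    (l₁ : Br 1 m f U₁ t₁ q₁) (l₂ : Br 1 m f U₂ t₂ q₂)
    (b₁ : Br (-1) m f U₁ r₁ p₁) (b₂ : Br (-1) m f U₂ r₂ p₂)
    (hβ₁ : β < U₁) (hU : U₁ < U₂) (j₁ : t₁ U₁ = r₁ U₁) (j₂ : t₂ U₂ = r₂ U₂)
    (N : NoDecay r₂ p₂) {a : ℝ} (ha : 0 < a) (hra : ∀ s ∈ Ioc 0 U₂, a ≤ r₂ s)
    (ht : t₂ β ≤ t₁ β)
    (hv : ∀ s ∈ Icc β U₁, t₁ s ^ (m + 1) * q₁ s < t₂ s ^ (m + 1) * q₂ s) : False := by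
  have hβ : 0 < β := h2.2.1.trans h2.2.2.1
  have hβ₂ : β < U₂ := hβ₁.trans hU
  have hfp : ∀ s, β ≤ s → 0 < f s := fun s hs => h2.2.2.2.1 s (h2.2.2.1.trans_le hs)
  have hFβ : Fint f β = 0 := h2.2.2.2.2.2.2
  choose! d hd1 hd2 using h3
  have hG : ∀ s, β < s → 0 ≤ 2 * ((m:ℝ) + 2) * d s - m := by
    intro s hs
    have := hd1 s hs
    push_cast at this
    rw [div_le_iff₀ (by positivity)] at this
    linarith
  have i₁ : ∀ {x}, β ≤ x → x < U₁ → x ∈ Ioo 0 U₁ := fun h h' => ⟨hβ.trans_le h, h'⟩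
  have i₂ : ∀ {x}, β ≤ x → x < U₂ → x ∈ Ioo 0 U₂ := fun h h' => ⟨hβ.trans_le h, h'⟩
  have Ql₁ := Qcont hf h2 l₁
  have Ql₂ := Qcont hf h2 l₂
  have Qr₁ := Qcont hf h2 b₁
  have Qr₂ := Qcont hf h2 b₂
  have dl₁ : ∀ x, β < x → x < U₁ → _ := fun x hx hx' => l₁.dQ hf (i₁ hx.le hx') (hfp x hx.le) (hd2 x hx)
  have dl₂ : ∀ x, β < x → x < U₂ → _ := fun x hx hx' => l₂.dQ hf (i₂ hx.le hx') (hfp x hx.le) (hd2 x hx)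
  have dr₁ : ∀ x, β < x → x < U₁ → _ := fun x hx hx' => b₁.dQ hf (i₁ hx.le hx') (hfp x hx.le) (hd2 x hx)
  have dr₂ : ∀ x, β < x → x < U₂ → _ := fun x hx hx' => b₂.dQ hf (i₂ hx.le hx') (hfp x hx.le) (hd2 x hx)
  -- values at β on the left
  have c1 : Qf 1 m f t₁ q₁ β < Qf 1 m f t₂ q₂ β := by
    have x1 := i₁ le_rfl hβ₁
    have x2 := i₂ le_rfl hβ₂
    have ht2 := l₂.rpos β ⟨x2.1, x2.2.le⟩
    have ht1 : 0 < t₁ β := by linarith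
    have hq1 := l₁.ppos β x1
    have hq2 := l₂.ppos β x2
    have hvβ := hv β ⟨le_rfl, hβ₁.le⟩
    have hX : t₁ β * q₁ β < t₂ β * q₂ β := by
      by_contra hc
      have hc' : t₂ β * q₂ β ≤ t₁ β * q₁ β := not_lt.mp hc
      have : t₂ β ^ m * (t₂ β * q₂ β) ≤ t₁ β ^ m * (t₁ β * q₁ β) := by gcongr
      rw [pow_succ, pow_succ] at hvβ
      linarith
    have e : ∀ t q : ℝ → ℝ, Qf 1 m f t q β = (t β ^ (m + 1) * q β) * (t β * q β) := by
      intro t q; simp only [Qf, hFβ]; ring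
    rw [e, e]
    exact mul_lt_mul'' hvβ hX (by positivity) (by positivity)
  -- left comparison up to U₁
  have c2 : Qf 1 m f t₁ q₁ U₁ < Qf 1 m f t₂ q₂ U₁ := by
    have := mono_of_hd (g := fun s => Qf 1 m f t₂ q₂ s - Qf 1 m f t₁ q₁ s)
      (g' := fun s => 1 * (t₂ s ^ (m + 1) * q₂ s) * (2 * (m + 2) * d s - m)
        - 1 * (t₁ s ^ (m + 1) * q₁ s) * (2 * (m + 2) * d s - m)) hβ₁.le
      ((Ql₂.mono (Icc_subset_Icc_right hU.le)).sub Ql₁)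
      (fun x hx => (dl₂ x hx.1 (hx.2.trans hU)).sub (dl₁ x hx.1 hx.2))
      (fun x hx => by
        have h5 := hv x ⟨hx.1.le, hx.2.le⟩
        have h6 := mul_nonneg (sub_nonneg.mpr h5.le) (hG x hx.1)
        linarith)
    linarith
  have c3 : Qf 1 m f t₂ q₂ U₁ ≤ Qf 1 m f t₂ q₂ U₂ := by
    refine mono_of_hd (g := Qf 1 m f t₂ q₂) (g' := fun s => 1 * (t₂ s ^ (m + 1) * q₂ s) * (2 * (m + 2) * d s - m))
      hU.le (Ql₂.mono (Icc_subset_Icc_left hβ₁.le)) (fun x hx => dl₂ x (hβ₁.trans hx.1) hx.2) ?_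
    intro x hx
    have x2 := i₂ (hβ₁.trans hx.1).le hx.2
    have h5 := l₂.rpos x ⟨x2.1, x2.2.le⟩
    have h6 := l₂.ppos x x2
    have := hG x (hβ₁.trans hx.1)
    positivity
  have c4 : ∀ x ∈ Icc β U₂, Qf (-1) m f r₂ p₂ U₂ ≤ Qf (-1) m f r₂ p₂ x := by
    intro x hx
    refine anti_of_hd (g := Qf (-1) m f r₂ p₂) (g' := fun s => -1 * (r₂ s ^ (m + 1) * p₂ s) * (2 * (m + 2) * d s - m))
      hx.2 (Qr₂.mono (Icc_subset_Icc_left hx.1)) (fun y hy => dr₂ y (hx.1.trans_lt hy.1) hy.2) ?_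
    intro y hy
    have x2 := i₂ (hx.1.trans_lt hy.1).le hy.2
    have h5 := b₂.rpos y ⟨x2.1, x2.2.le⟩
    have h6 := b₂.ppos y x2
    have h7 := hG y (hx.1.trans_lt hy.1)
    have : 0 ≤ (r₂ y ^ (m + 1) * p₂ y) * (2 * (m + 2) * d y - m) := by positivity
    linarith
  have eU₁ : Qf 1 m f t₁ q₁ U₁ = Qf (-1) m f r₁ p₁ U₁ := by
    simp [Qf, l₁.pU, b₁.pU, j₁]
  have eU₂ : Qf 1 m f t₂ q₂ U₂ = Qf (-1) m f r₂ p₂ U₂ := by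
    simp [Qf, l₂.pU, b₂.pU, j₂]
  have c5 : Qf (-1) m f r₁ p₁ U₁ < Qf (-1) m f r₂ p₂ U₁ := by
    have := c4 U₁ ⟨hβ₁.le, hU.le⟩
    linarith
  have Qpos : ∀ x ∈ Icc β U₂, 0 < Qf (-1) m f r₂ p₂ x := by
    intro x hx
    refine lt_of_lt_of_le ?_ (c4 x hx)
    have h5 := b₂.rpos U₂ ⟨hβ.trans hβ₂, le_rfl⟩
    have h6 := F_pos hf h2 hβ₂
    have e : Qf (-1) m f r₂ p₂ U₂ = 2 * r₂ U₂ ^ (m + 2) * Fint f U₂ := by simp [Qf, b₂.pU]; ring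
    rw [e]; positivity
  have sub₁ : Icc β U₁ ⊆ Ioc 0 U₁ := fun x hx => ⟨hβ.trans_le hx.1, hx.2⟩
  have sub₂ : Icc β U₁ ⊆ Ioc 0 U₂ := fun x hx => ⟨hβ.trans_le hx.1, hx.2.trans hU.le⟩
  -- the point s_d
  have hsd : ∃ x ∈ Ico β U₁, (∀ s ∈ Ioo x U₁, p₁ s < p₂ s) ∧
      r₂ x ^ (m + 1) * p₂ x ≤ r₁ x ^ (m + 1) * p₁ x ∧
      (r₁ x ^ (m + 1) * p₁ x) / (r₂ x ^ (m + 1) * p₂ x) * Qf (-1) m f r₂ p₂ x ≤ Qf (-1) m f r₁ p₁ x := by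
    by_cases hS : ∃ x ∈ Icc β U₁, 0 ≤ p₁ x - p₂ x
    · obtain ⟨x, hx, hpx⟩ := hS
      obtain ⟨y, hy, hy0, -, hy2⟩ := last_nonneg (z := fun x => p₁ x - p₂ x)
        ((b₁.pc.mono sub₁).sub (b₂.pc.mono sub₂)) hx hpx
        (by
          have := b₂.ppos U₁ (i₂ hβ₁.le hU)
          simp only [b₁.pU]; linarith)
      have hpp : p₁ y = p₂ y := by linarith
      have y1 := i₁ hy.1 hy.2
      have y2 := i₂ hy.1 (hy.2.trans hU)
      have hr1 := b₁.rpos y ⟨y1.1, y1.2.le⟩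
      have hr2 := b₂.rpos y ⟨y2.1, y2.2.le⟩
      have hp2 := b₂.ppos y y2
      have hder := deriv_nonpos_of_right hy.2 ((b₁.dp y y1).sub (b₂.dp y y2))
        (fun s hs => by
          have := hy2 s hs
          simp only [Pi.sub_apply]
          linarith)
      rw [hpp] at hder
      have hrr : r₂ y ≤ r₁ y := by
        by_contra hc
        push Not at hc
        have h5 : 1 / r₂ y < 1 / r₁ y := one_div_lt_one_div_of_lt hr1 hc
        have h6 : (0:ℝ) < ((m:ℝ) + 1) * (1 / r₁ y - 1 / r₂ y) := mul_pos (by positivity) (by linarith)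
        have e : (-(-1 * ((m:ℝ) + 1) / r₁ y) - f y / p₂ y) - (-(-1 * ((m:ℝ) + 1) / r₂ y) - f y / p₂ y)
          = ((m:ℝ) + 1) * (1 / r₁ y - 1 / r₂ y) := by ring
        linarith
      refine ⟨y, hy, fun s hs => by linarith [hy2 s ⟨hs.1, hs.2.le⟩], ?_, ?_⟩
      · rw [hpp]; gcongr
      · have hE := b₂.en y y2
        have e : Qf (-1) m f r₁ p₁ y - (r₁ y ^ (m + 1) * p₁ y) / (r₂ y ^ (m + 1) * p₂ y) * Qf (-1) m f r₂ p₂ y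
          = r₁ y ^ (m + 1) * ((r₁ y - r₂ y) * (p₂ y ^ 2 + 2 * Fint f y)) := by
          simp only [Qf, hpp]
          have := (hfp y hy.1)
          field_simp
          ring
        have : 0 ≤ r₁ y ^ (m + 1) * ((r₁ y - r₂ y) * (p₂ y ^ 2 + 2 * Fint f y)) :=
          mul_nonneg (by positivity) (mul_nonneg (by linarith) hE.le)
        linarith
    · push Not at hS
      have hpβ := hS β ⟨le_rfl, hβ₁.le⟩
      have hrr : r₂ β ≤ r₁ β := right2 hf h2 b₁ b₂ hβ₁ hβ₂ N ha hra (by linarith)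
      have hY := right1 hf h2 b₁ b₂ hβ₁ hβ₂ N ⟨hβ, le_rfl⟩ hrr
      have y1 := i₁ le_rfl hβ₁
      have y2 := i₂ le_rfl hβ₂
      have hr1 := b₁.rpos β ⟨y1.1, y1.2.le⟩
      have hr2 := b₂.rpos β ⟨y2.1, y2.2.le⟩
      have hp1 := b₁.ppos β y1
      have hp2 := b₂.ppos β y2
      have e : ∀ p : ℝ → ℝ, 0 < p β → wf f p β = p β := by
        intro p hp
        simp [wf, hFβ, Real.sqrt_sq hp.le]
      rw [e p₁ hp1, e p₂ hp2] at hY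
      refine ⟨β, ⟨le_rfl, hβ₁⟩, fun s hs => by linarith [hS s ⟨hs.1.le, hs.2.le⟩], ?_, ?_⟩
      · rw [pow_succ, pow_succ, mul_assoc, mul_assoc]; gcongr
      · have e : Qf (-1) m f r₁ p₁ β - (r₁ β ^ (m + 1) * p₁ β) / (r₂ β ^ (m + 1) * p₂ β) * Qf (-1) m f r₂ p₂ β
          = r₁ β ^ (m + 1) * p₁ β * (r₁ β * p₁ β - r₂ β * p₂ β) := by
          simp only [Qf, hFβ]
          field_simp
          ring
        have : 0 ≤ r₁ β ^ (m + 1) * p₁ β * (r₁ β * p₁ β - r₂ β * p₂ β) :=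
          mul_nonneg (by positivity) (by linarith)
        linarith
  obtain ⟨x, hx, hxp, hxv, hxD⟩ := hsd
  have subx : Icc x U₁ ⊆ Icc β U₁ := Icc_subset_Icc_left hx.1
  have cv₁ : ContinuousOn (fun s => r₁ s ^ (m + 1) * p₁ s) (Icc x U₁) :=
    ((b₁.rc.mono (subx.trans sub₁)).pow _).mul (b₁.pc.mono (subx.trans sub₁))
  have cv₂ : ContinuousOn (fun s => r₂ s ^ (m + 1) * p₂ s) (Icc x U₁) :=
    ((b₂.rc.mono (subx.trans sub₂)).pow _).mul (b₂.pc.mono (subx.trans sub₂))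
  have vpos₂ : ∀ y ∈ Icc β U₁, 0 < r₂ y ^ (m + 1) * p₂ y := by
    intro y hy
    have y2 := i₂ hy.1 (hy.2.trans_lt hU)
    have := b₂.rpos y ⟨y2.1, y2.2.le⟩
    have := b₂.ppos y y2
    positivity
  -- the point s_c
  obtain ⟨y, hy, hy0, -, hy2⟩ := last_nonneg
    (z := fun s => r₁ s ^ (m + 1) * p₁ s - r₂ s ^ (m + 1) * p₂ s) (cv₁.sub cv₂)
    (t := x) ⟨le_rfl, hx.2.le⟩ (by linarith)
    (by
      have := vpos₂ U₁ ⟨hβ₁.le, le_rfl⟩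
      simp only [b₁.pU]; linarith)
  have hβy : β ≤ y := hx.1.trans hy.1
  have hvy : r₁ y ^ (m + 1) * p₁ y = r₂ y ^ (m + 1) * p₂ y := by linarith
  have hD := mono_of_hd
    (g := fun s => Qf (-1) m f r₁ p₁ s - (r₁ s ^ (m + 1) * p₁ s) / (r₂ s ^ (m + 1) * p₂ s) * Qf (-1) m f r₂ p₂ s)
    (g' := fun s => -1 * (r₁ s ^ (m + 1) * p₁ s) * (2 * (m + 2) * d s - m) -
      ((-(r₁ s ^ (m + 1) * f s / p₁ s) * (r₂ s ^ (m + 1) * p₂ s)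
          - (r₁ s ^ (m + 1) * p₁ s) * -(r₂ s ^ (m + 1) * f s / p₂ s)) / (r₂ s ^ (m + 1) * p₂ s) ^ 2
          * Qf (-1) m f r₂ p₂ s
        + (r₁ s ^ (m + 1) * p₁ s) / (r₂ s ^ (m + 1) * p₂ s)
          * (-1 * (r₂ s ^ (m + 1) * p₂ s) * (2 * (m + 2) * d s - m)))) hy.1
    (by
      have s3 : Icc x y ⊆ Icc x U₁ := Icc_subset_Icc_right hy.2.le
      refine (Qr₁.mono (s3.trans subx)).sub (((cv₁.mono s3).div (cv₂.mono s3) ?_).mul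
        (Qr₂.mono ((s3.trans subx).trans (Icc_subset_Icc_right hU.le))))
      intro z hz
      exact (vpos₂ z (subx (s3 hz))).ne')
    (fun z hz => by
      have hz1 : β < z := hx.1.trans_lt hz.1
      have hz2 : z < U₁ := hz.2.trans hy.2
      exact (dr₁ z hz1 hz2).sub (((b₁.dv (i₁ hz1.le hz2)).div (b₂.dv (i₂ hz1.le (hz2.trans hU)))
        (vpos₂ z ⟨hz1.le, hz2.le⟩).ne').mul (dr₂ z hz1 (hz2.trans hU))))
    (fun z hz => by
      have hz1 : β < z := hx.1.trans_lt hz.1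
      have hz2 : z < U₁ := hz.2.trans hy.2
      have z1 := i₁ hz1.le hz2
      have z2 := i₂ hz1.le (hz2.trans hU)
      have hr1 := b₁.rpos z ⟨z1.1, z1.2.le⟩
      have hr2 := b₂.rpos z ⟨z2.1, z2.2.le⟩
      have hp1 := b₁.ppos z z1
      have hp2 := b₂.ppos z z2
      have hpp := hxp z ⟨hz.1, hz2⟩
      have hQ := Qpos z ⟨hz1.le, (hz2.trans hU).le⟩
      have hfz := hfp z hz1.le
      have e : (-1 * (r₁ z ^ (m + 1) * p₁ z) * (2 * ((m:ℝ) + 2) * d z - m) -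
        ((-(r₁ z ^ (m + 1) * f z / p₁ z) * (r₂ z ^ (m + 1) * p₂ z)
          - (r₁ z ^ (m + 1) * p₁ z) * -(r₂ z ^ (m + 1) * f z / p₂ z)) / (r₂ z ^ (m + 1) * p₂ z) ^ 2
          * Qf (-1) m f r₂ p₂ z
        + (r₁ z ^ (m + 1) * p₁ z) / (r₂ z ^ (m + 1) * p₂ z)
          * (-1 * (r₂ z ^ (m + 1) * p₂ z) * (2 * ((m:ℝ) + 2) * d z - m))))
        = r₁ z ^ (m + 1) * f z * Qf (-1) m f r₂ p₂ z / (r₂ z ^ (m + 1) * p₁ z * p₂ z ^ 3)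
          * (p₂ z ^ 2 - p₁ z ^ 2) := by
        generalize Qf (-1) m f r₂ p₂ z = q
        field_simp
        ring
      rw [e]
      apply mul_nonneg (by positivity)
      nlinarith)
  have hQy := anti_of_hd (g := fun s => Qf (-1) m f r₂ p₂ s - Qf (-1) m f r₁ p₁ s)
    (g' := fun s => -1 * (r₂ s ^ (m + 1) * p₂ s) * (2 * (m + 2) * d s - m)
      - -1 * (r₁ s ^ (m + 1) * p₁ s) * (2 * (m + 2) * d s - m)) hy.2.le
    ((Qr₂.mono (Icc_subset_Icc hβy hU.le)).sub (Qr₁.mono (Icc_subset_Icc_left hβy)))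
    (fun z hz => (dr₂ z (hβy.trans_lt hz.1) (hz.2.trans hU)).sub (dr₁ z (hβy.trans_lt hz.1) hz.2))
    (fun z hz => by
      have h5 := hy2 z ⟨hz.1, hz.2.le⟩
      have h6 := mul_nonneg (by linarith : 0 ≤ r₂ z ^ (m + 1) * p₂ z - r₁ z ^ (m + 1) * p₁ z)
        (hG z (hβy.trans_lt hz.1))
      linarith)
  have hv0 := vpos₂ y ⟨hβy, hy.2.le⟩
  rw [hvy, div_self hv0.ne'] at hD
  linarith

end PartCore

section PartS

lemma slope_sgn {g : ℝ → ℝ} {d t : ℝ} (h : HasDerivAt g d t) (hd : d < 0) :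
    ∃ δ > 0, (∀ s ∈ Ioo (t - δ) t, g t < g s) ∧ (∀ s ∈ Ioo t (t + δ), g s < g t) := by
  have h1 := hasDerivAt_iff_tendsto_slope.1 h
  have h2 := h1.eventually (gt_mem_nhds hd)
  rw [eventually_nhdsWithin_iff, Metric.eventually_nhds_iff] at h2
  obtain ⟨δ, hδ, H⟩ := h2
  refine ⟨δ, hδ, fun s hs => ?_, fun s hs => ?_⟩
  · have := H (y := s) (by rw [Real.dist_eq, abs_lt]; constructor <;> linarith [hs.1, hs.2])
      (by simpa using hs.2.ne)
    rw [slope_def_field, div_neg_iff] at this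
    rcases this with h | h <;> linarith [hs.2, h.1, h.2]
  · have := H (y := s) (by rw [Real.dist_eq, abs_lt]; constructor <;> linarith [hs.1, hs.2])
      (by simpa using hs.1.ne')
    rw [slope_def_field, div_neg_iff] at this
    rcases this with h | h <;> linarith [hs.1, h.1, h.2]

lemma sign_right {g : ℝ → ℝ} {z r : ℝ} (hzr : z < r) (hc : ContinuousOn g (Icc z r))
    (hd : ∀ x ∈ Icc z r, g x = 0 → ∃ d < 0, HasDerivAt g d x) (hz : g z = 0) : g r < 0 := by
  obtain ⟨d, hd0, hdd⟩ := hd z ⟨le_rfl, hzr.le⟩ hz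
  obtain ⟨δ, hδ, -, H⟩ := slope_sgn hdd hd0
  set r1 := min (z + δ / 2) r with hr1
  have hz1 : z < r1 := lt_min (by linarith) hzr
  have h1r : r1 ≤ r := min_le_right _ _
  have hg1 : g r1 < 0 := by
    rw [← hz]; exact H r1 ⟨hz1, lt_of_le_of_lt (min_le_left _ _) (by linarith)⟩
  refine boot_up (z := g) (l := r1) (u := r) (hc.mono (Icc_subset_Icc_left hz1.le)) ?_ r ⟨h1r, le_rfl⟩
  intro t ht hs
  rcases eq_or_lt_of_le ht.1 with e | hlt
  · rwa [← e]
  have hle : g t ≤ 0 := by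
    have hct : ContinuousWithinAt g (Ico r1 t) t :=
      (hc t ⟨hz1.le.trans ht.1, ht.2⟩).mono (fun x hx => ⟨hz1.le.trans hx.1, hx.2.le.trans ht.2⟩)
    have hne : (nhdsWithin t (Ico r1 t)).NeBot := by
      rw [← mem_closure_iff_nhdsWithin_neBot, closure_Ico hlt.ne]; exact ⟨ht.1, le_rfl⟩
    exact le_of_tendsto hct (eventually_nhdsWithin_of_forall fun s h => (hs s h).le)
  rcases eq_or_lt_of_le hle with e | h
  · exfalso
    obtain ⟨d', hd0', hdd'⟩ := hd t ⟨hz1.le.trans ht.1, ht.2⟩ e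
    obtain ⟨δ', hδ', H', -⟩ := slope_sgn hdd' hd0'
    set s := max r1 (t - δ' / 2)
    have hst : s < t := max_lt hlt (by linarith)
    have := H' s ⟨lt_of_lt_of_le (by linarith) (le_max_right _ _), hst⟩
    have := hs s ⟨le_max_left _ _, hst⟩
    linarith
  · exact h

lemma sign_left {g : ℝ → ℝ} {z r : ℝ} (hzr : z < r) (hc : ContinuousOn g (Icc z r))
    (hd : ∀ x ∈ Icc z r, g x = 0 → ∃ d < 0, HasDerivAt g d x) (hr : g r = 0) : 0 < g z := by
  have := sign_right (g := fun x => - g (-x)) (z := -r) (r := -z) (by linarith)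
    ((hc.comp continuousOn_neg (fun x hx => ⟨by linarith [hx.2], by linarith [hx.1]⟩)).neg)
    (fun x hx h => by
      obtain ⟨d, h0, h1⟩ := hd (-x) ⟨by linarith [hx.2], by linarith [hx.1]⟩ (by linarith)
      refine ⟨d, h0, ?_⟩
      exact ((h1.comp x (hasDerivAt_neg x)).neg).congr_deriv (by ring)) (by simp [hr])
  simp only [neg_neg] at this
  linarith

lemma inv_cont {u g : ℝ → ℝ} {K S : Set ℝ} (hK : IsCompact K) (hu : ContinuousOn u K)
    (hi : InjOn u K) (hg : ∀ s ∈ S, g s ∈ K ∧ u (g s) = s) : ContinuousOn g S := by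
  rw [continuousOn_iff_isClosed]
  intro t ht
  refine ⟨u '' (K ∩ t), ((hK.inter_right ht).image_of_continuousOn
    (hu.mono inter_subset_left)).isClosed, ?_⟩
  ext s
  constructor
  · rintro ⟨h1, h2⟩
    exact ⟨⟨g s, ⟨(hg s h2).1, h1⟩, (hg s h2).2⟩, h2⟩
  · rintro ⟨⟨k, hk, rfl⟩, h2⟩
    have := hi (hg _ h2).1 hk.1 (hg _ h2).2
    exact ⟨by rw [mem_preimage, this]; exact hk.2, h2⟩

variable {m : ℕ} {a : ℝ} {f u u' : ℝ → ℝ} {β B : ℝ}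

lemma sol_dd (h : IsPosSolExt (m + 2) a f u u') {r : ℝ} (hr : a < r) :
    HasDerivAt u' (-((m + 1) / r * u' r + f (u r))) r := by
  have := h.2.2.2.1 r hr
  convert this using 4
  push_cast; ring

lemma sol_nonneg (h : IsPosSolExt (m + 2) a f u u') {r : ℝ} (hr : a ≤ r) : 0 ≤ u r := by
  rcases eq_or_lt_of_le hr with e | hlt
  · rw [← e, h.2.2.2.2.1]
  · exact (h.2.2.2.2.2.1 r hlt).le

lemma sol_dcont (hf : ContinuousOn f (Ici 0)) (ha : 0 < a)
    (h : IsPosSolExt (m + 2) a f u u') : ContinuousOn u' (Ici a) := by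
  set φ : ℝ → ℝ := fun t => (t + a) ^ (m + 1) * f (u (t + a)) with hφ
  have hφc : ContinuousOn φ (Ici 0) := by
    apply ContinuousOn.mul (by fun_prop)
    refine hf.comp (h.1.comp (by fun_prop) (fun x hx => ?_)) (fun x hx => ?_)
    · have : (0:ℝ) ≤ x := hx
      show a ≤ x + a; linarith
    · have : (0:ℝ) ≤ x := hx
      exact sol_nonneg h (by linarith)
  set g : ℝ → ℝ := fun r => r ^ (m + 1) * u' r + Fint φ (r - a) with hg
  have hgd : ∀ r, a < r → HasDerivAt g 0 r := by
    intro r hr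
    have hr0 : r ≠ 0 := by linarith
    have h1 := ((hasDerivAt_pow (m + 1) r).mul (sol_dd h hr))
    have h2 := (F_hasDerivAt hφc (s := r - a) (by linarith)).comp r ((hasDerivAt_id r).sub_const a)
    refine (h1.add h2).congr_deriv ?_
    simp only [hφ, sub_add_cancel]
    push_cast
    field_simp
    ring
  have hconst : ∀ r, a < r → g r = g (a + 1) := by
    intro r hr
    have key : ∀ x y, a < x → x ≤ y → g x = g y := by
      intro x y hx hxy
      have hcc : ContinuousOn g (Icc x y) :=
        fun t ht => (hgd t (hx.trans_le ht.1)).continuousAt.continuousWithinAt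
      exact le_antisymm
        (mono_of_hd (g' := fun _ => 0) hxy hcc (fun t ht => hgd t (hx.trans ht.1)) (fun _ _ => le_rfl))
        (anti_of_hd (g' := fun _ => 0) hxy hcc (fun t ht => hgd t (hx.trans ht.1)) (fun _ _ => le_rfl))
    rcases le_total r (a + 1) with h | h
    · exact key _ _ hr h
    · exact (key _ _ (by linarith) h).symm
  set v : ℝ → ℝ := fun r => (g (a + 1) - Fint φ (r - a)) / r ^ (m + 1) with hv
  have hvc : ContinuousOn v (Ici a) := by
    apply ContinuousOn.div
    · apply ContinuousOn.sub continuousOn_const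
      exact (F_cont hφc).comp (by fun_prop) (fun x hx => by
        have : a ≤ x := hx
        show 0 ≤ x - a; linarith)
    · fun_prop
    · intro x hx
      have : a ≤ x := hx
      have : 0 < x := by linarith
      positivity
  have huv : ∀ r, a < r → u' r = v r := by
    intro r hr
    have h1 := hconst r hr
    have : 0 < r := by linarith
    simp only [hv]
    rw [← h1, eq_div_iff (by positivity)]
    simp only [hg]; ring
  have hva : HasDerivWithinAt u (v a) (Ici a) a := by
    apply hasDerivWithinAt_Ici_of_tendsto_deriv (s := Ioi a)
    · exact fun x hx => (h.2.2.1 x hx).differentiableAt.differentiableWithinAt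
    · exact (h.1 a self_mem_Ici).mono Ioi_subset_Ici_self
    · exact self_mem_nhdsWithin
    · have h1 : Tendsto v (nhdsWithin a (Ioi a)) (nhds (v a)) :=
        (hvc a self_mem_Ici).mono Ioi_subset_Ici_self
      refine h1.congr' (eventually_nhdsWithin_of_forall fun x hx => ?_)
      show v x = deriv u x
      rw [(h.2.2.1 x hx).deriv, huv x hx]
  have hua : u' a = v a :=
    (uniqueDiffOn_Ici a a self_mem_Ici).eq_deriv _ (h.2.1 a self_mem_Ici) hva
  refine hvc.congr (fun x hx => ?_)
  rcases eq_or_lt_of_le (show a ≤ x from hx) with e | hlt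
  · rw [← e, hua]
  · exact huv x hlt

/-- twice the energy -/
noncomputable def Wf (f u u' : ℝ → ℝ) (r : ℝ) : ℝ := u' r ^ 2 + 2 * Fint f (u r)

lemma W_deriv (hf : ContinuousOn f (Ici 0))
    (h : IsPosSolExt (m + 2) a f u u') {r : ℝ} (hr : a < r) :
    HasDerivAt (Wf f u u') (-(2 * (m + 1) / r * u' r ^ 2)) r := by
  have h1 := (sol_dd h hr).pow 2
  have h2 := ((F_hasDerivAt hf (h.2.2.2.2.2.1 r hr)).comp r (h.2.2.1 r hr)).const_mul 2
  refine (h1.add h2).congr_deriv ?_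
  push_cast
  ring

lemma W_cont (hf : ContinuousOn f (Ici 0)) (ha : 0 < a)
    (h : IsPosSolExt (m + 2) a f u u') : ContinuousOn (Wf f u u') (Ici a) := by
  unfold Wf
  exact ((sol_dcont hf ha h).pow 2).add (continuousOn_const.mul
    ((F_cont hf).comp h.1 (fun x hx => sol_nonneg h hx)))

lemma W_anti (hf : ContinuousOn f (Ici 0)) (ha : 0 < a)
    (h : IsPosSolExt (m + 2) a f u u') {x y : ℝ} (hx : a ≤ x) (hxy : x ≤ y) :
    Wf f u u' y ≤ Wf f u u' x := by
  refine anti_of_hd hxy ((W_cont hf ha h).mono (fun t ht => hx.trans ht.1))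
    (fun t ht => W_deriv hf h (hx.trans_lt ht.1)) (fun t ht => ?_)
  have : 0 < t := by linarith [ht.1]
  have : 0 ≤ 2 * ((m:ℝ) + 1) / t * u' t ^ 2 := by positivity
  linarith

lemma W_pos (hf : ContinuousOn f (Ici 0)) (ha : 0 < a)
    (h : IsPosSolExt (m + 2) a f u u') {x : ℝ} (hx : a ≤ x) : 0 < Wf f u u' x := by
  have hlim : Tendsto (fun r => 2 * Fint f (u r)) atTop (nhds 0) := by
    have h1 : Tendsto (Fint f) (nhdsWithin 0 (Ici 0)) (nhds (Fint f 0)) :=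
      (F_cont hf) 0 self_mem_Ici
    rw [F_zero] at h1
    have h2 : Tendsto u atTop (nhdsWithin 0 (Ici 0)) :=
      tendsto_nhdsWithin_iff.2 ⟨h.2.2.2.2.2.2, by
        filter_upwards [eventually_ge_atTop a] with r hr using sol_nonneg h hr⟩
    simpa using (h1.comp h2).const_mul 2
  have hnn : ∀ r, a ≤ r → 0 ≤ Wf f u u' r := by
    intro r hr
    refine le_of_tendsto hlim ?_
    filter_upwards [eventually_ge_atTop r] with t ht
    have := W_anti hf ha h hr ht
    have h2 : Wf f u u' t = u' t ^ 2 + 2 * Fint f (u t) := rfl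
    nlinarith [sq_nonneg (u' t)]
  by_contra hcon
  push Not at hcon
  have hz : ∀ r, x ≤ r → Wf f u u' r = 0 := fun r hr =>
    le_antisymm ((W_anti hf ha h hx hr).trans hcon) (hnn r (hx.trans hr))
  have hd0 : ∀ r, x < r → u' r = 0 := by
    intro r hr
    have h1 : HasDerivAt (Wf f u u') 0 r := by
      apply (hasDerivAt_const r (0:ℝ)).congr_of_eventuallyEq
      filter_upwards [lt_mem_nhds hr] with t ht using hz t ht.le
    have h2 := h1.unique (W_deriv hf h (hx.trans_lt hr))
    have hr0 : 0 < r := by linarith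
    have h3 : 0 < 2 * ((m:ℝ) + 1) / r := by positivity
    by_contra hne
    have : 0 < u' r ^ 2 := by positivity
    nlinarith [mul_pos h3 this]
  have hc : ∀ r, x + 1 ≤ r → u (x + 1) ≤ u r := fun r hr =>
    mono_of_hd hr (h.1.mono (fun t ht => by
      have := ht.1
      show a ≤ t; linarith)) (fun t ht => h.2.2.1 t (show a < t by linarith [ht.1]))
      (fun t ht => (hd0 t (by linarith [ht.1])).ge)
  have : u (x + 1) ≤ 0 := ge_of_tendsto h.2.2.2.2.2.2 (by
    filter_upwards [eventually_ge_atTop (x+1)] with r hr using hc r hr)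
  have := h.2.2.2.2.2.1 (x + 1) (show a < x + 1 by linarith)
  linarith

lemma sol_crit (hf : ContinuousOn f (Ici 0)) (h2 : CondF2B f β B) (ha : 0 < a)
    (h : IsPosSolExt (m + 2) a f u u') {r : ℝ} (hr : a ≤ r) (h0 : u' r = 0) : β < u r := by
  by_contra hc
  push Not at hc
  have := W_pos hf ha h hr
  have h3 := F_nonpos hf h2 ⟨sol_nonneg h hr, hc⟩
  unfold Wf at this
  rw [h0] at this
  nlinarith

lemma sol_crit_neg (hf : ContinuousOn f (Ici 0)) (h2 : CondF2B f β B) (ha : 0 < a)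
    (h : IsPosSolExt (m + 2) a f u u') {r : ℝ} (hr : a < r) (h0 : u' r = 0) :
    ∃ d < 0, HasDerivAt u' d r := by
  refine ⟨_, ?_, sol_dd h hr⟩
  have := sol_crit hf h2 ha h hr.le h0
  have := h2.2.2.2.1 (u r) (h2.2.2.1.trans this)
  rw [h0]; linarith

lemma sol_a (hf : ContinuousOn f (Ici 0)) (ha : 0 < a)
    (h : IsPosSolExt (m + 2) a f u u') : 0 < u' a := by
  have h1 := W_pos hf ha h le_rfl
  unfold Wf at h1
  rw [h.2.2.2.2.1, F_zero] at h1
  have hne : u' a ≠ 0 := by rintro e; rw [e] at h1; simp at h1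
  refine lt_of_le_of_ne ?_ hne.symm
  have h3 := (h.2.1 a self_mem_Ici)
  rw [hasDerivWithinAt_iff_tendsto_slope] at h3
  have hE : Ici a \ {a} = Ioi a := by
    ext x; simp only [Set.mem_sdiff, mem_Ici, mem_singleton_iff, mem_Ioi]
    exact ⟨fun h => lt_of_le_of_ne h.1 (Ne.symm h.2), fun h => ⟨h.le, h.ne'⟩⟩
  rw [hE] at h3
  refine ge_of_tendsto h3 (eventually_nhdsWithin_of_forall fun x hx => ?_)
  rw [slope_def_field, h.2.2.2.2.1]
  have hx' : a < x := hx
  exact div_nonneg (by linarith [h.2.2.2.2.2.1 x hx]) (by linarith)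

lemma sol_max (hf : ContinuousOn f (Ici 0)) (h2 : CondF2B f β B) (ha : 0 < a)
    (h : IsPosSolExt (m + 2) a f u u') : ∃ M, a < M ∧ u' M = 0 ∧ β < u M ∧
      (∀ r ∈ Ico a M, 0 < u' r) ∧ (∀ r, M < r → u' r < 0) := by
  have hu1 : 0 < u (a + 1) := h.2.2.2.2.2.1 (a+1) (show a < a+1 by linarith)
  obtain ⟨R, hR⟩ := (eventually_atTop.1 (h.2.2.2.2.2.2.eventually (gt_mem_nhds hu1)))
  set R' := max R (a + 1)
  have hRR : a + 1 ≤ R' := le_max_right _ _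
  obtain ⟨M, hM, hmax⟩ := isCompact_Icc.exists_isMaxOn (s := Icc a R') ⟨a, le_rfl, by linarith⟩
    (h.1.mono (fun x hx => hx.1))
  have hM1 : u (a + 1) ≤ u M := hmax ⟨by linarith, hRR⟩
  have haM : a < M := by
    refine lt_of_le_of_ne hM.1 ?_
    rintro e
    rw [← e, h.2.2.2.2.1] at hM1; linarith
  have hMR : M < R' := by
    refine lt_of_le_of_ne hM.2 ?_
    rintro e
    have := hR M (e ▸ le_max_left _ _)
    linarith
  have h0 : u' M = 0 := (hmax.isLocalMax (Icc_mem_nhds haM hMR)).hasDerivAt_eq_zero (h.2.2.1 M haM)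
  have hdc := sol_dcont hf ha h
  refine ⟨M, haM, h0, sol_crit hf h2 ha h haM.le h0, fun r hr => ?_, fun r hr => ?_⟩
  · rcases eq_or_lt_of_le hr.1 with e | hlt
    · rw [← e]; exact sol_a hf ha h
    · exact sign_left hr.2 (hdc.mono fun x hx => hr.1.trans hx.1)
        (fun x hx hx0 => sol_crit_neg hf h2 ha h (hlt.trans_le hx.1) hx0) h0
  · exact sign_right hr (hdc.mono fun x hx => haM.le.trans hx.1)
        (fun x hx hx0 => sol_crit_neg hf h2 ha h (haM.trans_le hx.1) hx0) h0

lemma mkBr (hf : ContinuousOn f (Ici 0)) (ha : 0 < a)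
    (h : IsPosSolExt (m + 2) a f u u') {σ U : ℝ} (hσ : σ = 1 ∨ σ = -1) {g : ℝ → ℝ}
    (hg : ∀ s ∈ Ioc 0 U, a < g s ∧ u (g s) = s) (hc : ContinuousOn g (Ioc 0 U))
    (hs : ∀ s ∈ Ioo 0 U, 0 < σ * u' (g s)) (hU : u' (g U) = 0) :
    Br σ m f U g (fun s => σ * u' (g s)) := by
  have hI : ∀ s ∈ Ioo 0 U, s ∈ Ioc 0 U := fun s hs => ⟨hs.1, hs.2.le⟩
  have hdr : ∀ s ∈ Ioo 0 U, HasDerivAt g (u' (g s))⁻¹ s := by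
    intro s hs'
    have hne : u' (g s) ≠ 0 := fun e => by have := hs s hs'; rw [e] at this; simp at this
    refine HasDerivAt.of_local_left_inverse
      (hc.continuousAt (Filter.mem_of_superset (Ioo_mem_nhds hs'.1 hs'.2) hI))
      (h.2.2.1 _ (hg s (hI s hs')).1) hne ?_
    filter_upwards [Ioo_mem_nhds hs'.1 hs'.2] with t ht using (hg t (hI t ht)).2
  refine ⟨fun s hs => ha.trans (hg s hs).1, hs, hc, ?_, ?_, ?_, by simp [hU], ?_⟩
  · exact continuousOn_const.mul ((sol_dcont hf ha h).comp hc (fun s hs => (hg s hs).1.le))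
  · intro s hs'
    have hne : u' (g s) ≠ 0 := fun e => by have := hs s hs'; rw [e] at this; simp at this
    refine (hdr s hs').congr_deriv ?_
    rcases hσ with rfl | rfl
    · simp
    · field_simp
  · intro s hs'
    have hne : u' (g s) ≠ 0 := fun e => by have := hs s hs'; rw [e] at this; simp at this
    obtain ⟨hag, hug⟩ := hg s (hI s hs')
    have hg0 : g s ≠ 0 := by linarith
    refine (((sol_dd h hag).comp s (hdr s hs')).const_mul σ).congr_deriv ?_
    rw [hug]
    rcases hσ with rfl | rfl <;> field_simp <;> ring
  · intro s hs'
    obtain ⟨hag, hug⟩ := hg s (hI s hs')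
    have := W_pos hf ha h hag.le
    unfold Wf at this
    rw [hug] at this
    have hσ2 : σ ^ 2 = 1 := by rcases hσ with rfl | rfl <;> norm_num
    simp only [mul_pow, hσ2, one_mul]
    exact this

lemma branches (hf : ContinuousOn f (Ici 0)) (h2 : CondF2B f β B) (ha : 0 < a)
    (h : IsPosSolExt (m + 2) a f u u') : ∃ U tl pl rr pr, β < U ∧ Br 1 m f U tl pl ∧
      ContinuousOn tl (Icc 0 U) ∧ ContinuousOn pl (Icc 0 U) ∧ tl 0 = a ∧ pl 0 = u' a ∧
      Br (-1) m f U rr pr ∧ tl U = rr U ∧ NoDecay rr pr ∧ (∀ s ∈ Ioc 0 U, a ≤ rr s) ∧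
      (∀ s ∈ Ioc 0 U, a < tl s ∧ u (tl s) = s ∧ u' (tl s) = pl s) := by
  obtain ⟨M, haM, hM0, hβM, hpos, hneg⟩ := sol_max hf h2 ha h
  have hdc := sol_dcont hf ha h
  have hmono : StrictMonoOn u (Icc a M) := by
    apply strictMonoOn_of_deriv_pos (convex_Icc _ _) (h.1.mono fun x hx => hx.1)
    rw [interior_Icc]; intro x hx
    rw [(h.2.2.1 x hx.1).deriv]; exact hpos x ⟨hx.1.le, hx.2⟩
  have hanti : StrictAntiOn u (Ici M) := by
    apply strictAntiOn_of_deriv_neg (convex_Ici _) (h.1.mono fun x hx => haM.le.trans hx)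
    rw [interior_Ici]; intro x hx
    rw [(h.2.2.1 x (haM.trans hx)).deriv]; exact hneg x hx
  set U := u M with hU
  have hβ0 : 0 < β := h2.2.1.trans h2.2.2.1
  have hU0 : 0 < U := hβ0.trans hβM
  have hua : u a = 0 := h.2.2.2.2.1
  have hexl : ∀ s, ∃ t, s ∈ Icc 0 U → t ∈ Icc a M ∧ u t = s := by
    intro s
    by_cases hs : s ∈ Icc 0 U
    · have := intermediate_value_Icc haM.le (h.1.mono (fun x (hx : x ∈ Icc a M) => hx.1))
      rw [hua] at this
      obtain ⟨t, ht, e⟩ := this hs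
      exact ⟨t, fun _ => ⟨ht, e⟩⟩
    · exact ⟨0, fun hh => absurd hh hs⟩
  choose tl htl using hexl
  have hsmall : ∀ s, 0 < s → ∃ R, M < R ∧ u R < s := by
    intro s hs
    obtain ⟨R, hR⟩ := ((h.2.2.2.2.2.2.eventually (gt_mem_nhds hs)).and (eventually_gt_atTop M)).exists
    exact ⟨R, hR.2, hR.1⟩
  have hexr : ∀ s, ∃ t, s ∈ Ioc 0 U → M ≤ t ∧ u t = s := by
    intro s
    by_cases hs : s ∈ Ioc 0 U
    · obtain ⟨R, hMR, hR⟩ := hsmall s hs.1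
      have := intermediate_value_Icc' hMR.le (h.1.mono (fun x (hx : x ∈ Icc M R) => haM.le.trans hx.1))
      obtain ⟨t, ht, e⟩ := this ⟨hR.le, hs.2⟩
      exact ⟨t, fun _ => ⟨ht.1, e⟩⟩
    · exact ⟨0, fun hh => absurd hh hs⟩
  choose rr hrr using hexr
  have htlc : ContinuousOn tl (Icc 0 U) :=
    inv_cont isCompact_Icc (h.1.mono (fun x (hx : x ∈ Icc a M) => hx.1)) hmono.injOn htl
  have htla : tl 0 = a := hmono.injOn (htl 0 ⟨le_rfl, hU0.le⟩).1 ⟨le_rfl, haM.le⟩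
    (by rw [(htl 0 ⟨le_rfl, hU0.le⟩).2, hua])
  have htlU : tl U = M := hmono.injOn (htl U ⟨hU0.le, le_rfl⟩).1 ⟨haM.le, le_rfl⟩
    (htl U ⟨hU0.le, le_rfl⟩).2
  have hrrU : rr U = M := hanti.injOn (hrr U ⟨hU0, le_rfl⟩).1 self_mem_Ici
    (hrr U ⟨hU0, le_rfl⟩).2
  have hrru : ∀ r, M ≤ r → rr (u r) = r := by
    intro r hr
    have hm : u r ∈ Ioc 0 U := ⟨h.2.2.2.2.2.1 r (haM.trans_le hr),
      hanti.antitoneOn self_mem_Ici hr hr⟩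
    exact hanti.injOn (hrr _ hm).1 hr (hrr _ hm).2
  have hrrc : ContinuousOn rr (Ioc 0 U) := by
    intro s hs
    obtain ⟨R, hMR, hR⟩ := hsmall s hs.1
    have hc : ContinuousOn rr (Icc (u R) U) := by
      refine inv_cont (K := Icc M R) isCompact_Icc (h.1.mono (fun x (hx : x ∈ Icc M R) => haM.le.trans hx.1))
        (hanti.injOn.mono (fun x hx => hx.1)) (fun t ht => ?_)
      have h0 : 0 < u R := h.2.2.2.2.2.1 R (haM.trans hMR)
      obtain ⟨h3, h4⟩ := hrr t ⟨h0.trans_le ht.1, ht.2⟩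
      refine ⟨⟨h3, ?_⟩, h4⟩
      by_contra hcon
      push Not at hcon
      have := hanti (mem_Ici.2 hMR.le) (mem_Ici.2 h3) hcon
      rw [h4] at this
      linarith [ht.1]
    refine (hc s ⟨hR.le, hs.2⟩).mono_of_mem_nhdsWithin ?_
    rw [mem_nhdsWithin]
    exact ⟨Ioi (u R), isOpen_Ioi, hR, fun y hy => ⟨le_of_lt hy.1, hy.2.2⟩⟩
  have hIl : ∀ s ∈ Ioc 0 U, a < tl s ∧ u (tl s) = s := by
    intro s hs
    obtain ⟨h3, h4⟩ := htl s ⟨hs.1.le, hs.2⟩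
    refine ⟨lt_of_le_of_ne h3.1 ?_, h4⟩
    rintro e
    rw [← e, hua] at h4
    linarith [hs.1]
  have hbl := mkBr hf ha h (σ := 1) (U := U) (g := tl) (Or.inl rfl) hIl
    (htlc.mono fun x hx => ⟨hx.1.le, hx.2⟩) (fun s hs => by
      rw [one_mul]
      obtain ⟨h3, h4⟩ := htl s ⟨hs.1.le, hs.2.le⟩
      refine hpos _ ⟨h3.1, lt_of_le_of_ne h3.2 ?_⟩
      rintro e
      rw [e] at h4
      linarith [hs.2]) (by rw [htlU, hM0])
  have hbr := mkBr hf ha h (σ := -1) (U := U) (g := rr) (Or.inr rfl)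
    (fun s hs => ⟨haM.trans_le (hrr s hs).1, (hrr s hs).2⟩)
    hrrc (fun s hs => by
      obtain ⟨h3, h4⟩ := hrr s ⟨hs.1, hs.2.le⟩
      have := hneg (rr s) (lt_of_le_of_ne h3 (by
        rintro e
        rw [← e] at h4
        linarith [hs.2]))
      linarith) (by rw [hrrU, hM0])
  refine ⟨U, tl, _, rr, _, hβM, hbl, htlc, ?_, htla, ?_, hbr, by rw [htlU, hrrU], ?_, ?_, ?_⟩
  · exact continuousOn_const.mul (hdc.comp htlc (fun s hs => (htl s hs).1.1))
  · simp [htla]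
  · intro c hc s₁ hs₁
    by_contra hcon
    push Not at hcon
    obtain ⟨R, hR⟩ := eventually_atTop.1 ((h.2.2.2.2.2.2.eventually (gt_mem_nhds hs₁)).and
      (eventually_gt_atTop M))
    have hMR : M < R := (hR R le_rfl).2
    have hle : ∀ r, R ≤ r → u r + c * Real.log r ≤ u R + c * Real.log R := by
      intro r hr
      refine anti_of_hd (g := fun r => u r + c * Real.log r) (g' := fun r => u' r + c * r⁻¹) hr ?_ ?_ ?_
      · refine (h.1.mono fun x hx => ?_).add (continuousOn_const.mul (Real.continuousOn_log.mono fun x hx => ?_))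
        · have := hx.1
          show a ≤ x; linarith
        · have := hx.1
          show x ≠ 0
          have : 0 < x := by linarith
          exact this.ne'
      · intro x hx
        have hx1 := hx.1
        exact (h.2.2.1 x (show a < x by linarith)).add
          ((Real.hasDerivAt_log (by linarith)).const_mul c)
      · intro x hx
        have hx1 := hx.1
        have hx0 : 0 < x := by linarith
        have h3 := hcon (u x) ⟨h.2.2.2.2.2.1 x (show a < x by linarith), (hR x hx1.le).1⟩
        rw [hrru x (by linarith)] at h3
        have h5 : u' x + c * x⁻¹ = (c - x * (-1 * u' x)) / x := by field_simp; ring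
        rw [h5]
        exact div_nonpos_of_nonpos_of_nonneg (by linarith) hx0.le
    obtain ⟨r, hr⟩ := ((Real.tendsto_log_atTop.eventually_gt_atTop
      ((u R + c * Real.log R) / c)).and (eventually_ge_atTop R)).exists
    have h3 := hle r hr.2
    have h4 := hr.1
    rw [div_lt_iff₀ hc] at h4
    have h5 : 0 < u r := h.2.2.2.2.2.1 r (show a < r by linarith [hr.2])
    linarith
  · exact fun s hs => haM.le.trans (hrr s hs).1
  · exact fun s hs => ⟨(hIl s hs).1, (hIl s hs).2, by simp⟩

end PartS

section PartU

lemma inv_diff {μ p q : ℝ} (hμ : 0 < μ) (hp : μ ≤ p) (hq : μ ≤ q) :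
    |1 / p - 1 / q| ≤ (1 / μ ^ 2) * |p - q| := by
  have hp0 : 0 < p := by linarith
  have hq0 : 0 < q := by linarith
  have e : 1 / p - 1 / q = (1 / (p * q)) * (q - p) := by field_simp
  rw [e, abs_mul, abs_sub_comm q p, abs_of_pos (by positivity : 0 < 1 / (p * q))]
  have : μ ^ 2 ≤ p * q := by nlinarith
  gcongr

variable {m : ℕ} {a : ℝ} {f : ℝ → ℝ} {β B : ℝ}

lemma lip_left {a μ K s : ℝ} (ha : 0 < a) (hμ : 0 < μ) (hK : |f s| ≤ K) :
    LipschitzOnWith (Real.toNNReal ((1 + K) * (1 / μ ^ 2) + (m + 1) * (1 / a ^ 2)))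
      (fun x : ℝ × ℝ => ((1 / x.2, -((m + 1) / x.1) - f s / x.2) : ℝ × ℝ))
      {x : ℝ × ℝ | a ≤ x.1 ∧ μ ≤ x.2} := by
  have hK0 : 0 ≤ K := (abs_nonneg _).trans hK
  apply LipschitzOnWith.of_dist_le_mul
  rintro ⟨t, p⟩ ⟨ht, hp⟩ ⟨t', q⟩ ⟨ht', hq⟩
  simp only at ht hp ht' hq
  rw [Real.coe_toNNReal _ (by positivity)]
  simp only [Prod.dist_eq, Real.dist_eq]
  have h1 := inv_diff hμ hp hq
  have h2 := inv_diff ha ht ht'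
  set D := max |t - t'| |p - q| with hD
  have hD1 : |t - t'| ≤ D := le_max_left _ _
  have hD2 : |p - q| ≤ D := le_max_right _ _
  have hD0 : 0 ≤ D := (abs_nonneg _).trans hD1
  have hμ2 : 0 < 1 / μ ^ 2 := by positivity
  have ha2 : 0 < 1 / a ^ 2 := by positivity
  have hm : (0:ℝ) < m + 1 := by positivity
  have h1' : |1 / p - 1 / q| ≤ 1 / μ ^ 2 * D := h1.trans (by gcongr)
  have h2' : |1 / t - 1 / t'| ≤ 1 / a ^ 2 * D := h2.trans (by gcongr)
  apply max_le
  · refine h1'.trans ?_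
    gcongr
    nlinarith [mul_nonneg hK0 hμ2.le, mul_pos hm ha2]
  · have e : -(((m:ℝ) + 1) / t) - f s / p - (-((m + 1) / t') - f s / q) =
        -((m + 1) * (1 / t - 1 / t')) + -(f s * (1 / p - 1 / q)) := by ring
    rw [e]
    refine (abs_add_le _ _).trans ?_
    rw [abs_neg, abs_neg, abs_mul, abs_mul, abs_of_pos hm]
    have h3 : |f s| * |1 / p - 1 / q| ≤ K * (1 / μ ^ 2 * D) := by gcongr
    have h4 : ((m:ℝ) + 1) * |1 / t - 1 / t'| ≤ (m + 1) * (1 / a ^ 2 * D) := by gcongr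
    nlinarith [mul_nonneg hμ2.le hD0]

lemma left_d0 {U : ℝ} {t p : ℝ → ℝ} (hf : ContinuousOn f (Ici 0)) (hU : 0 < U) (b : Br 1 m f U t p)
    (ct : ContinuousOn t (Icc 0 U)) (cp : ContinuousOn p (Icc 0 U)) (ht : 0 < t 0) (hp : 0 < p 0) :
    ∀ s ∈ Ico 0 U, HasDerivWithinAt (fun s => ((t s, p s) : ℝ × ℝ))
      (1 / p s, -((m + 1) / t s) - f s / p s) (Ici s) s := by
  intro s hs
  rcases eq_or_lt_of_le hs.1 with e | hlt
  · subst e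
    have hsub : Ioo 0 U ⊆ Icc 0 U := Ioo_subset_Icc_self
    have hn : Ioo 0 U ∈ nhdsWithin (0:ℝ) (Ioi 0) := Ioo_mem_nhdsGT hU
    have hle : nhdsWithin (0:ℝ) (Ioi 0) ≤ nhdsWithin 0 (Icc 0 U) := by
      apply nhdsWithin_le_of_mem
      exact Filter.mem_of_superset hn hsub
    have tt : Tendsto t (nhdsWithin 0 (Ioi 0)) (nhds (t 0)) := (ct 0 ⟨le_rfl, hU.le⟩).mono_left hle
    have tp : Tendsto p (nhdsWithin 0 (Ioi 0)) (nhds (p 0)) := (cp 0 ⟨le_rfl, hU.le⟩).mono_left hle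
    have tf : Tendsto f (nhdsWithin 0 (Ioi 0)) (nhds (f 0)) :=
      (hf 0 self_mem_Ici).mono_left (nhdsWithin_mono _ Ioi_subset_Ici_self)
    apply HasDerivWithinAt.prodMk
    · apply hasDerivWithinAt_Ici_of_tendsto_deriv (s := Ioo 0 U)
      · exact fun x hx => (b.dr x hx).differentiableAt.differentiableWithinAt
      · exact (ct 0 ⟨le_rfl, hU.le⟩).mono hsub
      · exact hn
      · have : Tendsto (fun s => 1 / p s) (nhdsWithin 0 (Ioi 0)) (nhds (1 / p 0)) :=
          tendsto_const_nhds.div tp hp.ne'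
        refine this.congr' ?_
        filter_upwards [hn] with x hx
        rw [(b.dr x hx).deriv]
    · apply hasDerivWithinAt_Ici_of_tendsto_deriv (s := Ioo 0 U)
      · exact fun x hx => (b.dp x hx).differentiableAt.differentiableWithinAt
      · exact (cp 0 ⟨le_rfl, hU.le⟩).mono hsub
      · exact hn
      · have : Tendsto (fun s => -(((m:ℝ) + 1) / t s) - f s / p s) (nhdsWithin 0 (Ioi 0))
            (nhds (-((m + 1) / t 0) - f 0 / p 0)) :=
          ((tendsto_const_nhds.div tt ht.ne').neg).sub (tf.div tp hp.ne')
        refine this.congr' ?_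
        filter_upwards [hn] with x hx
        rw [(b.dp x hx).deriv, one_mul]
  · have hs' : s ∈ Ioo 0 U := ⟨hlt, hs.2⟩
    have h2 := b.dp s hs'
    rw [one_mul] at h2
    exact ((b.dr s hs').prodMk h2).hasDerivWithinAt

lemma left_uniq {U₁ U₂ : ℝ} {t₁ p₁ t₂ p₂ : ℝ → ℝ} (hf : ContinuousOn f (Ici 0))
    (ha : 0 < a) (hU₁ : 0 < U₁) (hU₂ : 0 < U₂)
    (b₁ : Br 1 m f U₁ t₁ p₁) (b₂ : Br 1 m f U₂ t₂ p₂)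
    (ct₁ : ContinuousOn t₁ (Icc 0 U₁)) (cp₁ : ContinuousOn p₁ (Icc 0 U₁))
    (ct₂ : ContinuousOn t₂ (Icc 0 U₂)) (cp₂ : ContinuousOn p₂ (Icc 0 U₂))
    (h1 : t₁ 0 = a) (h2 : t₂ 0 = a) (ht₁ : ∀ s ∈ Ioc 0 U₁, a < t₁ s) (ht₂ : ∀ s ∈ Ioc 0 U₂, a < t₂ s)
    (hp : 0 < p₁ 0) (hpp : p₁ 0 = p₂ 0) :
    ∃ s, 0 < s ∧ s ≤ U₁ ∧ s ≤ U₂ ∧ t₁ s = t₂ s ∧ p₁ s = p₂ s := by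
  have key : ∀ {U : ℝ} {p : ℝ → ℝ}, 0 < U → ContinuousOn p (Icc 0 U) → p 0 = p₁ 0 →
      ∃ δ > 0, ∀ s ∈ Icc 0 U, s < δ → p₁ 0 / 2 ≤ p s := by
    intro U p hU hc h0
    have := (hc 0 ⟨le_rfl, hU.le⟩).eventually (lt_mem_nhds (show p₁ 0 / 2 < p 0 by linarith))
    rw [eventually_nhdsWithin_iff, Metric.eventually_nhds_iff] at this
    obtain ⟨δ, hδ, H⟩ := this
    refine ⟨δ, hδ, fun s hs hsδ => (H (y := s) ?_ hs).le⟩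
    rw [Real.dist_eq, sub_zero, abs_of_nonneg hs.1]; exact hsδ
  obtain ⟨δ₁, hδ₁, H₁⟩ := key hU₁ cp₁ rfl
  obtain ⟨δ₂, hδ₂, H₂⟩ := key hU₂ cp₂ hpp.symm
  set s0 := min (min U₁ U₂) (min δ₁ δ₂) with hs0
  have hs0p : 0 < s0 := lt_min (lt_min hU₁ hU₂) (lt_min hδ₁ hδ₂)
  have l1 : s0 ≤ U₁ := (min_le_left _ _).trans (min_le_left _ _)
  have l2 : s0 ≤ U₂ := (min_le_left _ _).trans (min_le_right _ _)
  have l3 : s0 ≤ δ₁ := (min_le_right _ _).trans (min_le_left _ _)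
  have l4 : s0 ≤ δ₂ := (min_le_right _ _).trans (min_le_right _ _)
  obtain ⟨K, hK⟩ := isCompact_Icc.exists_bound_of_continuousOn (s := Icc 0 s0)
    (hf.mono fun x hx => hx.1)
  have := ODE_solution_unique_of_mem_Icc_right (a := 0) (b := s0)
    (v := fun s (x : ℝ × ℝ) => ((1 / x.2, -((m + 1) / x.1) - f s / x.2) : ℝ × ℝ))
    (s := fun _ => {x : ℝ × ℝ | a ≤ x.1 ∧ p₁ 0 / 2 ≤ x.2})
    (K := Real.toNNReal ((1 + K) * (1 / (p₁ 0 / 2) ^ 2) + (m + 1) * (1 / a ^ 2)))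
    (f := fun s => ((t₁ s, p₁ s) : ℝ × ℝ)) (g := fun s => ((t₂ s, p₂ s) : ℝ × ℝ))
    (fun s hs => lip_left ha (by linarith) (by
      rw [← Real.norm_eq_abs]; exact hK s ⟨hs.1, hs.2.le⟩))
    ((ct₁.prodMk cp₁).mono (Icc_subset_Icc_right l1))
    (fun s hs => left_d0 hf hU₁ b₁ ct₁ cp₁ (by linarith) hp s ⟨hs.1, hs.2.trans_le l1⟩)
    (fun s hs => ⟨by
      rcases eq_or_lt_of_le hs.1 with e | hlt
      · rw [← e]; exact h1.ge
      · exact (ht₁ s ⟨hlt, by linarith [hs.2]⟩).le,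
      H₁ s ⟨hs.1, by linarith [hs.2]⟩ (by linarith [hs.2])⟩)
    ((ct₂.prodMk cp₂).mono (Icc_subset_Icc_right l2))
    (fun s hs => left_d0 hf hU₂ b₂ ct₂ cp₂ (by linarith) (by linarith) s ⟨hs.1, hs.2.trans_le l2⟩)
    (fun s hs => ⟨by
      rcases eq_or_lt_of_le hs.1 with e | hlt
      · rw [← e]; exact h2.ge
      · exact (ht₂ s ⟨hlt, by linarith [hs.2]⟩).le,
      H₂ s ⟨hs.1, by linarith [hs.2]⟩ (by linarith [hs.2])⟩)
    (by simp only [h1, h2, hpp]) ⟨hs0p.le, le_rfl⟩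
  simp only [Prod.mk.injEq] at this
  exact ⟨s0, hs0p, l1, l2, this.1, this.2⟩

lemma f_lip (h1 : CondF1 f) {lo hi : ℝ} (hlo : 0 < lo) :
    ∃ L, 0 ≤ L ∧ ∀ x ∈ Icc lo hi, ∀ y ∈ Icc lo hi, |f x - f y| ≤ L * |x - y| := by
  obtain ⟨L, hL⟩ := isCompact_Icc.exists_bound_of_continuousOn (s := Icc lo hi)
    (h1.2.2.1.mono fun x hx => lt_of_lt_of_le hlo hx.1)
  refine ⟨max L 0, le_max_right _ _, fun x hx y hy => ?_⟩
  have := Convex.norm_image_sub_le_of_norm_deriv_le (f := f) (s := Icc lo hi) (C := max L 0)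
    (x := y) (y := x)
    (fun z hz => h1.2.1 z (lt_of_lt_of_le hlo hz.1)) (fun z hz => (hL z hz).trans (le_max_left _ _))
    (convex_Icc _ _) hy hx
  simpa only [Real.norm_eq_abs] using this

lemma sol_uniq {u₁ u₁' u₂ u₂' : ℝ → ℝ} (h1 : CondF1 f) (ha : 0 < a)
    (s₁ : IsPosSolExt (m + 2) a f u₁ u₁') (s₂ : IsPosSolExt (m + 2) a f u₂ u₂')
    {r0 : ℝ} (hr0 : a < r0) (e : u₁ r0 = u₂ r0) (e' : u₁' r0 = u₂' r0) :
    ∀ r, a < r → u₁ r = u₂ r := by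
  intro r hr
  obtain ⟨c, hac, hc⟩ := exists_between (lt_min hr0 hr)
  obtain ⟨d, hd⟩ := exists_gt (max r0 r)
  have hcr0 : c < r0 := hc.trans_le (min_le_left _ _)
  have hcr : c < r := hc.trans_le (min_le_right _ _)
  have hr0d : r0 < d := (le_max_left _ _).trans_lt hd
  have hrd : r < d := (le_max_right _ _).trans_lt hd
  have bd : ∀ {u u' : ℝ → ℝ}, IsPosSolExt (m + 2) a f u u' → ∃ lo hi, 0 < lo ∧
      ∀ t ∈ Icc c d, u t ∈ Icc lo hi := by
    intro u u' h
    have hcc : ContinuousOn u (Icc c d) := h.1.mono fun x hx => hac.le.trans hx.1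
    have hne : (Icc c d).Nonempty := ⟨r, hcr.le, hrd.le⟩
    obtain ⟨x, hx, hmin⟩ := isCompact_Icc.exists_isMinOn hne hcc
    obtain ⟨y, hy, hmax⟩ := isCompact_Icc.exists_isMaxOn hne hcc
    exact ⟨u x, u y, h.2.2.2.2.2.1 x (hac.trans_le hx.1), fun t ht => ⟨hmin ht, hmax ht⟩⟩
  obtain ⟨lo₁, hi₁, hl₁, B₁⟩ := bd s₁
  obtain ⟨lo₂, hi₂, hl₂, B₂⟩ := bd s₂
  set lo := min lo₁ lo₂ with hlo
  set hi := max hi₁ hi₂ with hhi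
  obtain ⟨L, hL0, hL⟩ := f_lip h1 (lo := lo) (hi := hi) (lt_min hl₁ hl₂)
  have := ODE_solution_unique_of_mem_Ioo (a := c) (b := d) (t₀ := r0)
    (v := fun r (x : ℝ × ℝ) => ((x.2, -((m + 1) / r * x.2 + f x.1)) : ℝ × ℝ))
    (s := fun _ => {x : ℝ × ℝ | x.1 ∈ Icc lo hi})
    (K := Real.toNNReal (1 + (m + 1) / a + L))
    (f := fun s => ((u₁ s, u₁' s) : ℝ × ℝ)) (g := fun s => ((u₂ s, u₂' s) : ℝ × ℝ))
    (fun r hr => by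
      have hra : a < r := hac.trans hr.1
      have hr0 : 0 < r := ha.trans hra
      apply LipschitzOnWith.of_dist_le_mul
      rintro ⟨x, y⟩ hx ⟨x', y'⟩ hx'
      have hxx := hL x hx x' hx'
      rw [Real.coe_toNNReal _ (by positivity)]
      simp only [Prod.dist_eq, Real.dist_eq]
      set D := max |x - x'| |y - y'| with hD
      have hD1 : |x - x'| ≤ D := le_max_left _ _
      have hD2 : |y - y'| ≤ D := le_max_right _ _
      have hD0 : 0 ≤ D := (abs_nonneg _).trans hD1
      have hma : 0 < ((m:ℝ) + 1) / a := by positivity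
      have hmr : 0 < ((m:ℝ) + 1) / r := by positivity
      have hmm : ((m:ℝ) + 1) / r ≤ (m + 1) / a := by gcongr
      apply max_le
      · nlinarith [mul_nonneg hma.le hD0, mul_nonneg hL0 hD0]
      · have e : -(((m:ℝ) + 1) / r * y + f x) - -((m + 1) / r * y' + f x') =
          -((m + 1) / r * (y - y')) + -(f x - f x') := by ring
        rw [e]
        refine (abs_add_le _ _).trans ?_
        rw [abs_neg, abs_neg, abs_mul, abs_of_pos hmr]
        have h3 : ((m:ℝ) + 1) / r * |y - y'| ≤ (m + 1) / a * D := by gcongr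
        have h4 : L * |x - x'| ≤ L * D := by gcongr
        nlinarith)
    ⟨hcr0, hr0d⟩
    (fun t ht => ⟨(s₁.2.2.1 t (hac.trans ht.1)).prodMk (sol_dd s₁ (hac.trans ht.1)),
      (min_le_left _ _).trans (B₁ t ⟨ht.1.le, ht.2.le⟩).1,
      (B₁ t ⟨ht.1.le, ht.2.le⟩).2.trans (le_max_left _ _)⟩)
    (fun t ht => ⟨(s₂.2.2.1 t (hac.trans ht.1)).prodMk (sol_dd s₂ (hac.trans ht.1)),
      (min_le_right _ _).trans (B₂ t ⟨ht.1.le, ht.2.le⟩).1,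
      (B₂ t ⟨ht.1.le, ht.2.le⟩).2.trans (le_max_right _ _)⟩)
    (by simp only [e, e']) ⟨hcr, hrd⟩
  simp only [Prod.mk.injEq] at this
  exact this.1

lemma no_lt {u₁ u₁' u₂ u₂' : ℝ → ℝ} (hf : ContinuousOn f (Ici 0)) (h2 : CondF2B f β B)
    (h3 : CondF3 (m + 2) f β) (ha : 0 < a)
    (s₁ : IsPosSolExt (m + 2) a f u₁ u₁') (s₂ : IsPosSolExt (m + 2) a f u₂ u₂')
    (hlt : u₁' a < u₂' a) : False := by
  obtain ⟨U₁, t₁, q₁, r₁, p₁, hβ₁, l₁, ct₁, cq₁, e₁, d₁, b₁, j₁, N₁, A₁, I₁⟩ := branches hf h2 ha s₁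
  obtain ⟨U₂, t₂, q₂, r₂, p₂, hβ₂, l₂, ct₂, cq₂, e₂, d₂, b₂, j₂, N₂, A₂, I₂⟩ := branches hf h2 ha s₂
  obtain ⟨k1, k2⟩ := left_low hf h2 l₁ l₂ hβ₁ hβ₂ ct₁ ct₂ cq₁ cq₂ (by rw [e₁, e₂]) (by rw [e₁]; exact ha)
    (by rw [d₁]; exact sol_a hf ha s₁) (by rw [d₁, d₂]; exact hlt)
  obtain ⟨k3, k4⟩ := left_high h2 l₁ l₂ hβ₁ hβ₂ k1 k2
  exact core hf h2 h3 l₁ l₂ b₁ b₂ hβ₁ k3 j₁ j₂ N₂ ha A₂ k1 k4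

end PartU


/-- Theorem 2: under (f1)–(f3) with `B > 0`, the exterior problem (R) with `b = ∞`
has at most one positive solution for every `a ∈ (0,∞)`. -/
theorem uniqueness_exterior
    (n : ℕ) (hn : 2 ≤ n) (f : ℝ → ℝ) (β B : ℝ)
    (hf1 : CondF1 f) (hf2 : CondF2B f β B) (hf3 : CondF3 n f β)
    (a : ℝ) (ha : 0 < a)
    (u₁ u₁' u₂ u₂' : ℝ → ℝ)
    (h₁ : IsPosSolExt n a f u₁ u₁') (h₂ : IsPosSolExt n a f u₂ u₂') :
    ∀ r ∈ Ici a, u₁ r = u₂ r := by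
  obtain ⟨m, rfl⟩ : ∃ m, n = m + 2 := ⟨n - 2, by omega⟩
  have hf := hf1.1
  rcases lt_trichotomy (u₁' a) (u₂' a) with hlt | heq | hgt
  · exact (no_lt hf hf2 hf3 ha h₁ h₂ hlt).elim
  · intro r hr
    rcases eq_or_lt_of_le (show a ≤ r from hr) with e | hlt
    · rw [← e, h₁.2.2.2.2.1, h₂.2.2.2.2.1]
    · have hβ0 : 0 < β := hf2.2.1.trans hf2.2.2.1
      obtain ⟨U₁, t₁, q₁, r₁, p₁, hβ₁, l₁, ct₁, cq₁, e₁, d₁, -, -, -, -, I₁⟩ := branches hf hf2 ha h₁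
      obtain ⟨U₂, t₂, q₂, r₂, p₂, hβ₂, l₂, ct₂, cq₂, e₂, d₂, -, -, -, -, I₂⟩ := branches hf hf2 ha h₂
      obtain ⟨s, hs0, hs1, hs2, et, ep⟩ := left_uniq hf ha (hβ0.trans hβ₁) (hβ0.trans hβ₂) l₁ l₂
        ct₁ cq₁ ct₂ cq₂ e₁ e₂ (fun s hs => (I₁ s hs).1) (fun s hs => (I₂ s hs).1)
        (by rw [d₁]; exact sol_a hf ha h₁) (by rw [d₁, d₂, heq])
      obtain ⟨i1, i2, i3⟩ := I₁ s ⟨hs0, hs1⟩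
      obtain ⟨k1, k2, k3⟩ := I₂ s ⟨hs0, hs2⟩
      refine sol_uniq hf1 ha h₁ h₂ i1 ?_ ?_ r hlt
      · rw [i2, et, k2]
      · rw [i3, et, k3, ep]
  · exact (no_lt hf hf2 hf3 ha h₂ h₁ hgt).elim
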